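/- arXiv:0907.2009 — 3 statements merged into one kernel-verified Lean document; each statement's English description precedes it below -/
import Mathlib

section
/- Let W, W', W'' and G be random variables on a common probability space, with W nonnegative, all having finite first moments, and satisfying E|G·D| < ∞ and E|G·D'| < ∞, where D = W' − W and D' = W'' − W. Set r_1 = sup |E{G f(W') − G f(W) − f(W)}|, the supremum over all Lipschitz f: ℝ→ℝ with Lipschitz constant ≤ 1 and f(0) = 0; r_2 = E|E(GD | W'') − 1|; r_3 = E|GD·1[|D| > 1]|; r_3' = E|(GD − 1)·1[|D'| > 1]|; r_4 = E|G·(D² ∧ 1)|; r_4' = E|(GD − 1)·(|D'| ∧ 1)|. Then d_W(L(W), Exp(1)) ≤ r_1 + r_2 + 2r_3 + 2r_3' + 2r_4 + 2r_4'. -/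
open MeasureTheory ProbabilityTheory Set

noncomputable section

/-- The Wasserstein distance between two measures on `ℝ`: the supremum of
`|∫ h dP - ∫ h dQ|` over all `1`-Lipschitz functions `h : ℝ → ℝ`. -/
def dW (P Q : Measure ℝ) : ℝ :=
  ⨆ h : {h : ℝ → ℝ // LipschitzWith 1 h}, |∫ x, h.1 x ∂P - ∫ x, h.1 x ∂Q|

lemma expMeasure_one_eq : expMeasure 1 =
    (volume.restrict (Ioi (0 : ℝ))).withDensity fun x => ENNReal.ofReal (Real.exp (-x)) := by
  rw [restrict_Ioi_eq_restrict_Ici, ← withDensity_indicator measurableSet_Ici]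
  change volume.withDensity (exponentialPDF 1) = _
  congr 1
  ext x
  by_cases hx : 0 ≤ x
  · rw [exponentialPDF_of_nonneg hx, indicator_of_mem (mem_Ici.2 hx)]
    simp
  · rw [exponentialPDF_of_neg (not_le.1 hx), indicator_of_notMem (by simpa using hx)]

lemma integral_expMeasure_one (f : ℝ → ℝ) :
    ∫ x, f x ∂(expMeasure 1) = ∫ x in Ioi 0, Real.exp (-x) * f x := by
  rw [expMeasure_one_eq, integral_withDensity_eq_integral_toReal_smul (by fun_prop) (by simp)]
  simp [ENNReal.toReal_ofReal, Real.exp_nonneg]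

lemma integrable_expMeasure_one_iff (f : ℝ → ℝ) :
    Integrable f (expMeasure 1) ↔ IntegrableOn (fun x => Real.exp (-x) * f x) (Ioi 0) := by
  rw [expMeasure_one_eq, integrable_withDensity_iff_integrable_smul' (by fun_prop) (by simp)]
  simp [IntegrableOn, ENNReal.toReal_ofReal, Real.exp_nonneg]

instance : IsProbabilityMeasure (expMeasure 1) := isProbabilityMeasure_expMeasure one_pos

lemma integrable_id_expMeasure_one : Integrable (fun x => x) (expMeasure 1) := by
  rw [integrable_expMeasure_one_iff]
  convert Real.GammaIntegral_convergent (s := 2) two_pos using 3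
  norm_num

lemma integral_abs_expMeasure_one : ∫ x, |x| ∂(expMeasure 1) = 1 := by
  rw [integral_expMeasure_one]
  have h : Real.Gamma 2 = 1 := Real.Gamma_two
  rw [Real.Gamma_eq_integral two_pos] at h
  rw [← h]
  refine setIntegral_congr_fun measurableSet_Ioi fun x hx => ?_
  norm_num [abs_of_pos (mem_Ioi.1 hx)]

lemma abs_integral_le_of_abs_le {Ω : Type*} [MeasurableSpace Ω] {μ : Measure Ω} {f g : Ω → ℝ}
    (hg : Integrable g μ) (h : ∀ ω, |f ω| ≤ g ω) : |∫ ω, f ω ∂μ| ≤ ∫ ω, g ω ∂μ :=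
  norm_integral_le_of_norm_le (f := f) hg (Filter.Eventually.of_forall h)

lemma LipschitzWith.integrable_comp_of_integrable {Ω : Type*} [MeasurableSpace Ω] {μ : Measure Ω}
    [IsFiniteMeasure μ] {K : NNReal} {h : ℝ → ℝ} (hh : LipschitzWith K h) {X : Ω → ℝ}
    (hX : Integrable X μ) : Integrable (fun ω => h (X ω)) μ := by
  refine ((hX.abs.const_mul (K : ℝ)).add (integrable_const |h 0|)).mono'
    (hh.continuous.comp_aestronglyMeasurable hX.1) (Filter.Eventually.of_forall fun ω => ?_)
  have := hh.dist_le_mul (X ω) 0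
  rw [Real.dist_eq, Real.dist_eq, sub_zero] at this
  have h2 := abs_add_le (h (X ω) - h 0) (h 0)
  rw [sub_add_cancel] at h2
  simpa using h2.trans (by linarith)

/-- The mean of `h` under the standard exponential distribution shifted by `x`. -/
def expShift (h : ℝ → ℝ) (x : ℝ) : ℝ := ∫ z, h (x + z) ∂(expMeasure 1)

section Stein

variable {h : ℝ → ℝ}

lemma integrable_shift (hh : LipschitzWith 1 h) (x : ℝ) :
    Integrable (fun z => h (x + z)) (expMeasure 1) :=
  hh.integrable_comp_of_integrable ((integrable_const x).add integrable_id_expMeasure_one)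

lemma LipschitzWith.expShift (hh : LipschitzWith 1 h) : LipschitzWith 1 (expShift h) := by
  refine LipschitzWith.of_dist_le_mul fun x y => ?_
  rw [Real.dist_eq, _root_.expShift, _root_.expShift,
    ← integral_sub (integrable_shift hh x) (integrable_shift hh y)]
  have key := norm_integral_le_of_norm_le_const (μ := expMeasure 1) (C := dist x y)
    (f := fun z => h (x + z) - h (y + z)) (Filter.Eventually.of_forall fun z => by
      simpa [Real.dist_eq] using hh.dist_le_mul (x + z) (y + z))
  simpa using key

lemma abs_sub_expShift_le (hh : LipschitzWith 1 h) (x : ℝ) : |h x - expShift h x| ≤ 1 := by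
  have e : h x - expShift h x = ∫ z, (h x - h (x + z)) ∂(expMeasure 1) := by
    rw [integral_sub (integrable_const _) (integrable_shift hh x)]
    simp [expShift]
  rw [e]
  refine (abs_integral_le_of_abs_le integrable_id_expMeasure_one.abs fun z => ?_).trans_eq
    integral_abs_expMeasure_one
  simpa [Real.dist_eq] using hh.dist_le_mul x (x + z)

lemma expShift_eq (h : ℝ → ℝ) (x : ℝ) :
    expShift h x = Real.exp x * ∫ t in Ioi x, Real.exp (-t) * h t := by
  have key := (measurePreserving_add_left (volume : Measure ℝ) x).setIntegral_preimage_emb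
    (measurableEmbedding_addLeft x) (fun t => Real.exp (-t) * h t) (Ioi x)
  have e : (fun z => x + z) ⁻¹' Ioi x = Ioi 0 := by ext; simp
  rw [e] at key
  rw [expShift, integral_expMeasure_one, ← key, ← integral_const_mul]
  refine integral_congr_ae (Filter.Eventually.of_forall fun z => ?_)
  simp only
  rw [← mul_assoc, ← Real.exp_add]
  congr 2
  ring

lemma hasDerivAt_expShift (hh : LipschitzWith 1 h) (x : ℝ) :
    HasDerivAt (expShift h) (expShift h x - h x) x := by
  set k : ℝ → ℝ := fun t => Real.exp (-t) * h t with hk_def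
  have hk : Continuous k := by have := hh.continuous; fun_prop
  have hk0 : IntegrableOn k (Ioi 0) := by
    rw [← integrable_expMeasure_one_iff]
    simpa using integrable_shift hh 0
  have e : expShift h = fun y => Real.exp y * ((∫ t in Ioi 0, k t) - ∫ t in (0 : ℝ)..y, k t) := by
    ext y
    rw [expShift_eq, ← intervalIntegral.integral_interval_add_Ioi' (b := 0)
      (hk.intervalIntegrable y 0) hk0, intervalIntegral.integral_symm]
    ring
  have hd := (Real.hasDerivAt_exp x).mul ((hk.integral_hasStrictDerivAt 0 x).hasDerivAt.const_sub
    (∫ t in Ioi 0, k t))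
  have e2 : Real.exp x * k x = h x := by
    rw [hk_def]
    simp only
    rw [← mul_assoc, ← Real.exp_add]
    simp
  rw [e]
  convert! hd using 1
  simp only [mul_neg, e2]
  ring

/-- The Stein equation `f' - f = h - ∫ h d(expMeasure 1)` has a solution vanishing at `0` which is
`1`-Lipschitz and whose derivative is `2`-Lipschitz and bounded by `1`. -/
lemma exists_stein_solution (hh : LipschitzWith 1 h) :
    ∃ f f' : ℝ → ℝ, LipschitzWith 1 f ∧ f 0 = 0 ∧ LipschitzWith 2 f' ∧ (∀ x, |f' x| ≤ 1) ∧
      (∀ x, HasDerivAt f (f' x) x) ∧ ∀ x, f' x - f x = h x - ∫ z, h z ∂(expMeasure 1) := by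
  refine ⟨fun x => expShift h 0 - expShift h x, fun x => h x - expShift h x, ?_, by simp, ?_,
    abs_sub_expShift_le hh, fun x => ?_, fun x => ?_⟩
  · simpa using (LipschitzWith.const (expShift h 0)).sub hh.expShift
  · simpa [one_add_one_eq_two] using hh.sub hh.expShift
  · simpa using (hasDerivAt_expShift hh x).const_sub (expShift h 0)
  · simp [expShift]

end Stein

lemma abs_sub_sub_mul_le {f f' : ℝ → ℝ} (hf : ∀ x, HasDerivAt f (f' x) x) {K : NNReal}
    (hf' : LipschitzWith K f') (x y : ℝ) : |f y - f x - f' x * (y - x)| ≤ K * (y - x) ^ 2 := by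
  have hd : ∀ z ∈ uIcc x y, HasDerivWithinAt (fun z => f z - f' x * z) (f' z - f' x)
      (uIcc x y) z := fun z _ => by
    have := ((hf z).sub ((hasDerivAt_id z).const_mul (f' x))).hasDerivWithinAt (s := uIcc x y)
    rwa [mul_one] at this
  have key := (convex_uIcc x y).norm_image_sub_le_of_norm_hasDerivWithin_le (C := K * |y - x|)
    hd (fun z hz => ?_) left_mem_uIcc right_mem_uIcc
  · rw [Real.norm_eq_abs, Real.norm_eq_abs, mul_assoc, abs_mul_abs_self] at key
    convert! key using 2 <;> ring
  · refine (hf'.dist_le_mul z x).trans ?_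
    gcongr
    rw [Real.dist_eq]
    exact abs_sub_left_of_mem_uIcc hz

theorem wasserstein_bound_stein_coupling
    {Ω : Type*} [MeasurableSpace Ω] (μ : Measure Ω) [IsProbabilityMeasure μ]
    (W W' W'' G : Ω → ℝ)
    (hW : Measurable W) (hW' : Measurable W') (hW'' : Measurable W'') (hG : Measurable G)
    (hWnonneg : ∀ ω, 0 ≤ W ω)
    (hWint : Integrable W μ) (hW'int : Integrable W' μ)
    (hW''int : Integrable W'' μ) (hGint : Integrable G μ)
    (D D' : Ω → ℝ)
    (hD : D = fun ω => W' ω - W ω) (hD' : D' = fun ω => W'' ω - W ω)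
    (hGD : Integrable (fun ω => G ω * D ω) μ)
    (hGD' : Integrable (fun ω => G ω * D' ω) μ)
    (r1 r2 r3 r3' r4 r4' : ℝ)
    (hr1 : r1 = ⨆ f : {f : ℝ → ℝ // LipschitzWith 1 f ∧ f 0 = 0},
      |∫ ω, (G ω * f.1 (W' ω) - G ω * f.1 (W ω) - f.1 (W ω)) ∂μ|)
    (hr2 : r2 = ∫ ω, |(μ[fun ω => G ω * D ω | MeasurableSpace.comap W'' inferInstance]) ω - 1| ∂μ)
    (hr3 : r3 = ∫ ω in {ω | 1 < |D ω|}, |G ω * D ω| ∂μ)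
    (hr3' : r3' = ∫ ω in {ω | 1 < |D' ω|}, |G ω * D ω - 1| ∂μ)
    (hr4 : r4 = ∫ ω, |G ω * min ((D ω) ^ 2) 1| ∂μ)
    (hr4' : r4' = ∫ ω, |(G ω * D ω - 1) * min |D' ω| 1| ∂μ) :
    dW (Measure.map W μ) (expMeasure 1)
      ≤ r1 + r2 + 2 * r3 + 2 * r3' + 2 * r4 + 2 * r4' := by
  have hm := hW''.comap_le
  have hr3'0 : 0 ≤ r3' := by rw [hr3']; exact integral_nonneg fun ω => abs_nonneg _
  have : Nonempty {h : ℝ → ℝ // LipschitzWith 1 h} := ⟨⟨id, LipschitzWith.id⟩⟩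
  refine ciSup_le fun ⟨h, hh⟩ => ?_
  obtain ⟨f, f', hf, hf0, hf'L, hf'1, hfd, hstein⟩ := exists_stein_solution hh
  have hfm : Measurable f := hf.continuous.measurable
  have hf'm : Measurable f' := hf'L.continuous.measurable
  have hDm : Measurable D := by rw [hD]; exact hW'.sub hW
  have hD'm : Measurable D' := by rw [hD']; exact hW''.sub hW
  have hDω : ∀ ω, W' ω - W ω = D ω := fun ω => by rw [hD]
  have hD'ω : ∀ ω, W'' ω - W ω = D' ω := fun ω => by rw [hD']
  have hGD1 : Integrable (fun ω => G ω * D ω - 1) μ := hGD.sub (integrable_const 1)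
  have hfW : Integrable (fun ω => f (W ω)) μ := hf.integrable_comp_of_integrable hWint
  have hf'W : Integrable (fun ω => f' (W ω)) μ := hf'L.integrable_comp_of_integrable hWint
  have hGf {g : ℝ → ℝ} (hg : LipschitzWith 1 g) :
      (∀ ω, |G ω * g (W' ω) - G ω * g (W ω)| ≤ |G ω * D ω|) ∧
      Integrable (fun ω => G ω * g (W' ω) - G ω * g (W ω)) μ := by
    have hb : ∀ ω, |G ω * g (W' ω) - G ω * g (W ω)| ≤ |G ω * D ω| := fun ω => by
      rw [← mul_sub, abs_mul, abs_mul, ← hDω]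
      refine mul_le_mul_of_nonneg_left ?_ (abs_nonneg _)
      simpa [Real.dist_eq] using hg.dist_le_mul (W' ω) (W ω)
    have hgm := hg.continuous.measurable
    exact ⟨hb, hGD.abs.mono' (by fun_prop) (Filter.Eventually.of_forall hb)⟩
  have hT : Integrable (fun ω => G ω * f (W' ω) - G ω * f (W ω) - f (W ω)) μ :=
    (hGf hf).2.sub hfW
  have b1 : |∫ ω, (G ω * f (W' ω) - G ω * f (W ω) - f (W ω)) ∂μ| ≤ r1 := by
    rw [hr1]
    refine le_ciSup (f := fun g : {f : ℝ → ℝ // LipschitzWith 1 f ∧ f 0 = 0} =>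
      |∫ ω, (G ω * g.1 (W' ω) - G ω * g.1 (W ω) - g.1 (W ω)) ∂μ|)
      ⟨∫ ω, (|G ω * D ω| + |W ω|) ∂μ, ?_⟩ ⟨f, hf, hf0⟩
    rintro _ ⟨⟨g, hg, hg0⟩, rfl⟩
    refine abs_integral_le_of_abs_le (hGD.abs.add hWint.abs) fun ω => (abs_sub _ _).trans ?_
    refine add_le_add ((hGf hg).1 ω) ?_
    simpa [Real.dist_eq, hg0] using hg.dist_le_mul (W ω) 0
  have hS : MeasurableSet {ω | 1 < |D ω|} := measurableSet_lt measurable_const (by fun_prop)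
  have hI3 : Integrable ({ω | 1 < |D ω|}.indicator fun ω => |G ω * D ω|) μ :=
    hGD.abs.indicator hS
  have hI4 : Integrable (fun ω => |G ω * min ((D ω) ^ 2) 1|) μ := by
    refine hGint.abs.mono' (by fun_prop) (Filter.Eventually.of_forall fun ω => ?_)
    rw [Real.norm_eq_abs, abs_abs, abs_mul, abs_of_nonneg (by positivity : 0 ≤ min ((D ω) ^ 2) 1)]
    exact mul_le_of_le_one_right (abs_nonneg _) (min_le_right _ _)
  have hR : ∀ ω, |G ω * (f (W' ω) - f (W ω) - f' (W ω) * D ω)| ≤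
      2 * {ω | 1 < |D ω|}.indicator (fun ω => |G ω * D ω|) ω +
        2 * |G ω * min ((D ω) ^ 2) 1| := fun ω => by
    by_cases hω : 1 < |D ω|
    · rw [indicator_of_mem (show ω ∈ {ω | 1 < |D ω|} from hω)]
      refine le_add_of_le_of_nonneg ?_ (by positivity)
      rw [abs_mul, abs_mul, mul_left_comm]
      gcongr
      have l1 := hf.dist_le_mul (W' ω) (W ω)
      rw [Real.dist_eq, Real.dist_eq, hDω, NNReal.coe_one, one_mul] at l1
      have l2 : |f' (W ω) * D ω| ≤ |D ω| := by
        rw [abs_mul]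
        exact mul_le_of_le_one_left (abs_nonneg _) (hf'1 _)
      linarith [abs_sub (f (W' ω) - f (W ω)) (f' (W ω) * D ω)]
    · rw [indicator_of_notMem (show ω ∉ {ω | 1 < |D ω|} from hω), mul_zero, zero_add,
        min_eq_left ((sq_le_one_iff_abs_le_one _).2 (not_lt.1 hω)), abs_mul, abs_mul,
        mul_left_comm, abs_of_nonneg (sq_nonneg (D ω))]
      gcongr
      simpa [hDω] using abs_sub_sub_mul_le hfd hf'L (W ω) (W' ω)
  have hRi : Integrable (fun ω => G ω * (f (W' ω) - f (W ω) - f' (W ω) * D ω)) μ :=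
    ((hI3.const_mul 2).add (hI4.const_mul 2)).mono' (by fun_prop) (Filter.Eventually.of_forall hR)
  have b2 : |∫ ω, G ω * (f (W' ω) - f (W ω) - f' (W ω) * D ω) ∂μ| ≤ 2 * r3 + 2 * r4 := by
    refine (abs_integral_le_of_abs_le ((hI3.const_mul 2).add (hI4.const_mul 2)) hR).trans_eq ?_
    rw [integral_add' (hI3.const_mul 2) (hI4.const_mul 2), integral_const_mul, integral_const_mul,
      integral_indicator hS, hr3, hr4]
  have hI4' : Integrable (fun ω => |(G ω * D ω - 1) * min |D' ω| 1|) μ := by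
    refine hGD1.abs.mono' (by fun_prop) (Filter.Eventually.of_forall fun ω => ?_)
    rw [Real.norm_eq_abs, abs_abs, abs_mul, abs_of_nonneg (by positivity : 0 ≤ min |D' ω| 1)]
    exact mul_le_of_le_one_right (abs_nonneg _) (min_le_right _ _)
  have hQ : ∀ ω, |(G ω * D ω - 1) * (f' (W'' ω) - f' (W ω))| ≤
      2 * |(G ω * D ω - 1) * min |D' ω| 1| := fun ω => by
    rw [abs_mul, abs_mul, mul_left_comm, abs_of_nonneg (by positivity : 0 ≤ min |D' ω| 1)]
    gcongr
    rw [mul_min_of_nonneg _ _ zero_le_two]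
    refine le_min ?_ ?_
    · simpa [Real.dist_eq, hD'ω] using hf'L.dist_le_mul (W'' ω) (W ω)
    · linarith [abs_sub (f' (W'' ω)) (f' (W ω)), hf'1 (W'' ω), hf'1 (W ω)]
  have hQi : Integrable (fun ω => (G ω * D ω - 1) * (f' (W'' ω) - f' (W ω))) μ :=
    (hI4'.const_mul 2).mono' (by fun_prop) (Filter.Eventually.of_forall hQ)
  have b3 : |∫ ω, (G ω * D ω - 1) * (f' (W'' ω) - f' (W ω)) ∂μ| ≤ 2 * r4' := by
    rw [hr4', ← integral_const_mul]
    exact abs_integral_le_of_abs_le (hI4'.const_mul 2) hQ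
  have hf'W'' : StronglyMeasurable[MeasurableSpace.comap W'' inferInstance]
      (fun ω => f' (W'' ω)) := by
    exact (hf'm.comp (comap_measurable W'')).stronglyMeasurable
  have hf'W''m : AEStronglyMeasurable (fun ω => f' (W'' ω)) μ :=
    (hf'm.comp hW'').aestronglyMeasurable
  have hPi : Integrable (fun ω => f' (W'' ω) * (G ω * D ω)) μ :=
    hGD.bdd_mul (c := 1) hf'W''m (Filter.Eventually.of_forall fun ω => hf'1 _)
  have hf'W''i : Integrable (fun ω => f' (W'' ω)) μ := hf'L.integrable_comp_of_integrable hW''int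
  have hcE : Integrable (μ[fun ω => G ω * D ω | MeasurableSpace.comap W'' inferInstance]) μ :=
    integrable_condExp
  have b4 : |∫ ω, f' (W'' ω) * (G ω * D ω - 1) ∂μ| ≤ r2 := by
    have hpull := condExp_mul_of_stronglyMeasurable_left hf'W'' hPi hGD
    have e : ∫ ω, f' (W'' ω) * (G ω * D ω - 1) ∂μ = ∫ ω, f' (W'' ω) *
        ((μ[fun ω => G ω * D ω | MeasurableSpace.comap W'' inferInstance]) ω - 1) ∂μ := by
      simp only [mul_sub, mul_one]
      rw [integral_sub hPi hf'W''i, integral_sub (hcE.bdd_mul (c := 1) hf'W''m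
        (Filter.Eventually.of_forall fun ω => hf'1 _)) hf'W''i, ← integral_condExp hm]
      congr 1
      exact integral_congr_ae hpull
    rw [e, hr2]
    refine abs_integral_le_of_abs_le (hcE.sub (integrable_const 1)).abs fun ω => ?_
    rw [abs_mul]
    exact mul_le_of_le_one_left (abs_nonneg _) (hf'1 _)
  have hP1i : Integrable (fun ω => f' (W'' ω) * (G ω * D ω - 1)) μ :=
    hGD1.bdd_mul (c := 1) hf'W''m (Filter.Eventually.of_forall fun ω => hf'1 _)
  have hhW : Integrable (fun ω => h (W ω)) μ := hh.integrable_comp_of_integrable hWint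
  have key : ∫ x, h x ∂(Measure.map W μ) - ∫ x, h x ∂(expMeasure 1) =
      ∫ ω, (G ω * f (W' ω) - G ω * f (W ω) - f (W ω)) ∂μ
      - ∫ ω, G ω * (f (W' ω) - f (W ω) - f' (W ω) * D ω) ∂μ
      + ∫ ω, (G ω * D ω - 1) * (f' (W'' ω) - f' (W ω)) ∂μ
      - ∫ ω, f' (W'' ω) * (G ω * D ω - 1) ∂μ := by
    rw [← integral_sub' hT hRi, ← integral_add' (hT.sub hRi) hQi,
      ← integral_sub' ((hT.sub hRi).add hQi) hP1i,
      integral_map hW.aemeasurable hh.continuous.aestronglyMeasurable]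
    have e : ∫ x, h x ∂(expMeasure 1) = ∫ ω, (∫ x, h x ∂(expMeasure 1)) ∂μ := by simp
    rw [e, ← integral_sub hhW (integrable_const _)]
    refine integral_congr_ae (Filter.Eventually.of_forall fun ω => ?_)
    simp only [← hstein, Pi.sub_apply, Pi.add_apply]
    ring
  rw [key]
  rw [abs_le] at b1 b2 b3 b4 ⊢
  constructor <;> linarith [b1.1, b1.2, b2.1, b2.2, b3.1, b3.2, b4.1, b4.2]

end
end

section
/- Let W, W', W'' and G be random variables on a common probability space, with W nonnegative, all having finite first moments, and satisfying E|G·D| < ∞ and E|G·D'| < ∞, where D = W' − W and D' = W'' − W. Set r_1^{BW} = sup |E{G f(W') − G f(W) − f(W)}|, the supremum over all Lipschitz f: ℝ→ℝ with sup|f| ≤ 1, Lipschitz constant ≤ 1 and f(0) = 0; r_2 = E|E(GD | W'') − 1|. Then for any α > 0, β > 0 and β' > 0, d_K(L(W), Exp(1)) ≤ 2r_1^{BW} + 2r_2 + 2r_5 + 2r_5' + 22(αβ + 1)β' + 12αβ², where r_5 = E|GD·1[{|G| > α} ∪ {|D| > β}]| and r_5' = E|(1 − GD)·1[{|G| > α}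 ∪ {|D| > β} ∪ {|D'| > β'}]|. -/
open MeasureTheory ProbabilityTheory Set

noncomputable section

/-- The Kolmogorov distance between two measures on `ℝ`. -/
def dK (P Q : Measure ℝ) : ℝ :=
  ⨆ z : ℝ, |(P (Iic z)).toReal - (Q (Iic z)).toReal|

/-- The solution `f` of the Stein equation `f' x - f x = 1[x ≤ z] - (1 - exp (-z))` of the
standard exponential distribution. -/
def steinSol (z x : ℝ) : ℝ := Real.exp (-max (z - x) 0) - Real.exp (-z)

/-- The left derivative of `steinSol z`. -/
def steinDeriv (z x : ℝ) : ℝ := if x ≤ z then Real.exp (x - z) else 0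

lemma steinDeriv_sub_steinSol (z x : ℝ) :
    steinDeriv z x - steinSol z x = (Iic z).indicator 1 x - (1 - Real.exp (-z)) := by
  unfold steinDeriv steinSol
  by_cases h : x ≤ z
  · simp [h]
  · simp [h, max_eq_right (show z - x ≤ 0 by linarith)]

lemma steinDeriv_nonneg (z x : ℝ) : 0 ≤ steinDeriv z x := by
  unfold steinDeriv; split_ifs <;> positivity

lemma steinDeriv_le_one (z x : ℝ) : steinDeriv z x ≤ 1 := by
  unfold steinDeriv
  split_ifs with h
  · exact Real.exp_le_one_iff.2 (by linarith)
  · exact zero_le_one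

lemma abs_steinDeriv_sub_le_one (z x y : ℝ) : |steinDeriv z x - steinDeriv z y| ≤ 1 := by
  have := steinDeriv_nonneg z x
  have := steinDeriv_nonneg z y
  have := steinDeriv_le_one z x
  have := steinDeriv_le_one z y
  rw [abs_le]; constructor <;> linarith

lemma measurable_steinDeriv (z : ℝ) : Measurable (steinDeriv z) :=
  Measurable.ite measurableSet_Iic (by fun_prop) measurable_const

lemma exp_neg_sub_exp_neg_le {u v : ℝ} (hv : 0 ≤ v) (huv : v ≤ u) :
    Real.exp (-v) - Real.exp (-u) ≤ u - v := by
  have h1 : Real.exp (-u) = Real.exp (-v) * Real.exp (-(u - v)) := by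
    rw [← Real.exp_add]; ring_nf
  have h2 := Real.add_one_le_exp (-(u - v))
  have h3 : Real.exp (-v) ≤ 1 := Real.exp_le_one_iff.2 (by linarith)
  have h4 := Real.exp_pos (-v)
  rw [h1]
  nlinarith

lemma steinSol_mono (z : ℝ) : Monotone (steinSol z) := fun x y h => by
  unfold steinSol
  have : max (z - y) 0 ≤ max (z - x) 0 := max_le_max (by linarith) le_rfl
  have := Real.exp_le_exp.2 (neg_le_neg this)
  linarith

lemma steinSol_sub_le {z x y : ℝ} (h : x ≤ y) : steinSol z y - steinSol z x ≤ y - x := by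
  have h1 : max (z - y) 0 ≤ max (z - x) 0 := max_le_max (by linarith) le_rfl
  have h2 := exp_neg_sub_exp_neg_le (le_max_right (z - y) 0) h1
  have h3 : max (z - x) 0 - max (z - y) 0 ≤ y - x := by
    rcases max_cases (z - x) 0 with h | h <;> rcases max_cases (z - y) 0 with h' | h' <;>
      linarith
  unfold steinSol
  linarith

lemma lipschitzWith_steinSol (z : ℝ) : LipschitzWith 1 (steinSol z) := by
  refine LipschitzWith.of_le_add fun x y => ?_
  rw [Real.dist_eq]
  rcases le_total x y with h | h
  · linarith [steinSol_mono z h, abs_nonneg (x - y)]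
  · linarith [steinSol_sub_le (z := z) h, le_abs_self (x - y)]

lemma abs_steinSol_le_one {z : ℝ} (hz : 0 ≤ z) (x : ℝ) : |steinSol z x| ≤ 1 := by
  have h1 : Real.exp (-max (z - x) 0) ≤ 1 :=
    Real.exp_le_one_iff.2 (by linarith [le_max_right (z - x) 0])
  have h2 : Real.exp (-z) ≤ 1 := Real.exp_le_one_iff.2 (by linarith)
  have h3 := Real.exp_pos (-max (z - x) 0)
  have h4 := Real.exp_pos (-z)
  unfold steinSol
  rw [abs_le]; constructor <;> linarith

lemma steinSol_zero {z : ℝ} (hz : 0 ≤ z) : steinSol z 0 = 0 := by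
  simp [steinSol, hz]

/-- `steinDeriv z` is Lipschitz up to its jump at `z`. -/
lemma abs_steinDeriv_sub_le {z x y t : ℝ} (h : |y - x| ≤ t) :
    |steinDeriv z x - steinDeriv z y| ≤ t + (Icc (-t) t).indicator 1 (z - x) := by
  have ht := (abs_nonneg _).trans h
  rw [abs_le] at h
  by_cases hj : z - x ∈ Icc (-t) t
  · rw [indicator_of_mem hj]
    have := abs_steinDeriv_sub_le_one z x y
    simp only [Pi.one_apply]
    linarith
  rw [indicator_of_notMem hj, add_zero]
  rw [mem_Icc, not_and_or, not_le, not_le] at hj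
  unfold steinDeriv
  rcases hj with hj | hj
  · rw [if_neg (by linarith), if_neg (by linarith)]
    simpa using ht
  · rw [if_pos (by linarith), if_pos (by linarith)]
    rcases le_total x y with hxy | hxy
    · have := exp_neg_sub_exp_neg_le (v := z - y) (u := z - x) (by linarith) (by linarith)
      have h' := Real.exp_le_exp.2 (show x - z ≤ y - z by linarith)
      simp only [neg_sub] at this
      rw [abs_le]; constructor <;> linarith
    · have := exp_neg_sub_exp_neg_le (v := z - x) (u := z - y) (by linarith) (by linarith)
      have h' := Real.exp_le_exp.2 (show y - z ≤ x - z by linarith)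
      simp only [neg_sub] at this
      rw [abs_le]; constructor <;> linarith

lemma abs_steinSol_sub_sub_le_abs (z x y : ℝ) :
    |steinSol z y - steinSol z x - (y - x) * steinDeriv z x| ≤ |y - x| := by
  have h0 := steinDeriv_nonneg z x
  have h1 := steinDeriv_le_one z x
  rcases le_total x y with h | h
  · have h2 := steinSol_mono z h
    have h3 := steinSol_sub_le (z := z) h
    rw [abs_of_nonneg (sub_nonneg.2 h), abs_le]
    constructor <;> nlinarith
  · have h2 := steinSol_mono z h
    have h3 := steinSol_sub_le (z := z) h
    rw [abs_of_nonpos (sub_nonpos.2 h), abs_le]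
    constructor <;> nlinarith

lemma one_sub_one_add_mul_exp_neg_nonneg (t : ℝ) :
    0 ≤ 1 - (1 + t) * Real.exp (-t) := by
  have h1 := Real.add_one_le_exp t
  have h2 := Real.exp_pos (-t)
  have h3 : Real.exp t * Real.exp (-t) = 1 := by rw [← Real.exp_add]; simp
  nlinarith

lemma one_sub_one_add_mul_exp_neg_le {t : ℝ} (ht : 0 ≤ t) :
    1 - (1 + t) * Real.exp (-t) ≤ t ^ 2 := by
  have h1 := Real.add_one_le_exp (-t)
  nlinarith

lemma exp_neg_sub_one_add_le {t : ℝ} (ht : 0 ≤ t) : Real.exp (-t) - 1 + t ≤ t ^ 2 := by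
  have h1 := one_sub_one_add_mul_exp_neg_nonneg t
  by_contra! h
  nlinarith [mul_lt_mul_of_pos_left h (show 0 < 1 + t by linarith), pow_nonneg ht 3]

/-- First order Taylor expansion of `steinSol z`, up to the kink at `z`. -/
lemma abs_steinSol_sub_sub_le (z x d : ℝ) :
    |steinSol z (x + d) - steinSol z x - d * steinDeriv z x|
      ≤ d ^ 2 + max (|d| - |z - x|) 0 := by
  unfold steinSol steinDeriv
  have hm := le_max_right (|d| - |z - x|) 0
  have hm' := le_max_left (|d| - |z - x|) 0
  rcases le_or_gt x z with hx | hx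
  · rw [if_pos hx, max_eq_left (by linarith : 0 ≤ z - x)]
    rw [abs_of_nonneg (sub_nonneg.2 hx)] at *
    rcases le_or_gt (x + d) z with hd | hd
    · rw [max_eq_left (by linarith)]
      have e1 : Real.exp (-(z - (x + d))) = Real.exp (x - z) * Real.exp d := by
        rw [← Real.exp_add]; ring_nf
      have e2 : Real.exp (-(z - x)) = Real.exp (x - z) := by ring_nf
      have e3 : Real.exp (x - z) * Real.exp d - Real.exp (-z) - (Real.exp (x - z) - Real.exp (-z))
          - d * Real.exp (x - z) = Real.exp (x - z) * (Real.exp d - 1 - d) := by ring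
      have h1 := Real.add_one_le_exp d
      have h2 := Real.exp_pos (x - z)
      rw [e1, e2, e3, abs_of_nonneg (mul_nonneg h2.le (by linarith))]
      suffices Real.exp (x - z) * (Real.exp d - 1 - d) ≤ d ^ 2 by linarith
      rcases le_total d 0 with h0 | h0
      · have h3 := exp_neg_sub_one_add_le (t := -d) (by linarith)
        rw [neg_neg] at h3
        have h4 : Real.exp (x - z) ≤ 1 := Real.exp_le_one_iff.2 (by linarith)
        nlinarith
      · have h3 := one_sub_one_add_mul_exp_neg_le h0
        have h4 : Real.exp (x - z) ≤ Real.exp (-d) := Real.exp_le_exp.2 (by linarith)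
        have h5 : Real.exp d * Real.exp (-d) = 1 := by rw [← Real.exp_add]; simp
        nlinarith
    · have hd0 : 0 < d := by linarith
      rw [max_eq_right (by linarith : z - (x + d) ≤ 0)]
      rw [abs_of_pos hd0] at *
      have h1 := one_sub_one_add_mul_exp_neg_nonneg (z - x)
      have h2 := one_sub_one_add_mul_exp_neg_le (sub_nonneg.2 hx)
      have h3 : Real.exp (-(z - x)) ≤ 1 := Real.exp_le_one_iff.2 (by linarith)
      have h4 := Real.exp_pos (-(z - x))
      have e2 : Real.exp (x - z) = Real.exp (-(z - x)) := by ring_nf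
      have h5 : (z - x) ^ 2 ≤ d ^ 2 := by nlinarith
      rw [e2, neg_zero, Real.exp_zero, abs_le]
      constructor <;> nlinarith
  · rw [if_neg (not_le.2 hx), max_eq_right (by linarith : z - x ≤ 0)]
    rw [abs_of_neg (by linarith : z - x < 0)] at hm' ⊢
    rcases le_or_gt (x + d) z with hd | hd
    · rw [abs_of_neg (by linarith : d < 0)] at *
      rw [max_eq_left (by linarith : 0 ≤ z - (x + d))]
      have h1 := Real.add_one_le_exp (-(z - (x + d)))
      have h2 : Real.exp (-(z - (x + d))) ≤ 1 := Real.exp_le_one_iff.2 (by linarith)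
      rw [neg_zero, Real.exp_zero, abs_le]
      constructor <;> nlinarith
    · rw [max_eq_right (by linarith)]
      simp
      positivity

lemma lintegral_lintegral_sub_le {Ω : Type*} [MeasurableSpace Ω] (μ : Measure Ω)
    [IsProbabilityMeasure μ] {X : Ω → ℝ} (hX : Measurable X) {k : ℝ → ENNReal}
    (hk : Measurable k) {ε : ℝ} {c : ENNReal} (hc : ∀ a, μ (X ⁻¹' Ioc a (a + ε)) ≤ c) (y : ℝ) :
    ∫⁻ z in Ioc y (y + ε), ∫⁻ ω, k (z - X ω) ∂μ ≤ (∫⁻ s, k s) * c := by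
  have hI : Measurable ((Ioc y (y + ε)).indicator (1 : ℝ → ENNReal)) :=
    measurable_one.indicator measurableSet_Ioc
  calc
    _ = ∫⁻ ω, ∫⁻ z in Ioc y (y + ε), k (z - X ω) ∂volume ∂μ :=
      lintegral_lintegral_swap (by fun_prop)
    _ = ∫⁻ ω, ∫⁻ s, k s * (Ioc y (y + ε)).indicator 1 (s + X ω) ∂volume ∂μ := by
      refine lintegral_congr fun ω => ?_
      rw [← lintegral_indicator measurableSet_Ioc,
        ← lintegral_add_right_eq_self _ (X ω)]
      refine lintegral_congr fun s => ?_
      by_cases h : s + X ω ∈ Ioc y (y + ε) <;> simp [h]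
    _ = ∫⁻ s, ∫⁻ ω, k s * (Ioc y (y + ε)).indicator 1 (s + X ω) ∂μ :=
      lintegral_lintegral_swap (by fun_prop)
    _ ≤ ∫⁻ s, k s * c := by
      refine lintegral_mono fun s => ?_
      rw [lintegral_const_mul _ (by fun_prop)]
      gcongr
      refine le_trans (le_of_eq ?_) (hc (y - s))
      rw [← lintegral_indicator_one (hX measurableSet_Ioc)]
      refine lintegral_congr fun ω => ?_
      have : s + X ω ∈ Ioc y (y + ε) ↔ ω ∈ X ⁻¹' Ioc (y - s) (y - s + ε) := by
        simp only [mem_Ioc, mem_preimage]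
        constructor <;> rintro ⟨h, h'⟩ <;> constructor <;> linarith
      by_cases h : s + X ω ∈ Ioc y (y + ε)
      · rw [indicator_of_mem h, indicator_of_mem (this.1 h)]; simp
      · rw [indicator_of_notMem h, indicator_of_notMem (mt this.2 h)]
    _ = _ := lintegral_mul_const _ hk

lemma abs_integral_le_setIntegral_add {Ω : Type*} [MeasurableSpace Ω] {μ : Measure Ω}
    {F b c : Ω → ℝ} {S : Set Ω} (hS : MeasurableSet S) (hF : AEStronglyMeasurable F μ)
    (hb : Integrable b μ) (hc : Integrable c μ) (hc0 : ∀ ω, 0 ≤ c ω)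
    (hFb : ∀ ω ∈ S, |F ω| ≤ b ω) (hFc : ∀ ω ∉ S, |F ω| ≤ c ω) :
    |∫ ω, F ω ∂μ| ≤ ∫ ω in S, b ω ∂μ + ∫ ω, c ω ∂μ := by
  have hle : ∀ ω, |F ω| ≤ S.indicator b ω + c ω := fun ω => by
    by_cases h : ω ∈ S
    · rw [indicator_of_mem h]; linarith [hFb ω h, hc0 ω]
    · rw [indicator_of_notMem h]; linarith [hFc ω h]
  have hi : Integrable (fun ω => S.indicator b ω + c ω) μ := (hb.indicator hS).add hc
  calc |∫ ω, F ω ∂μ| ≤ ∫ ω, |F ω| ∂μ := abs_integral_le_integral_abs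
    _ ≤ ∫ ω, (S.indicator b ω + c ω) ∂μ :=
      integral_mono (hi.mono' hF.norm (.of_forall fun ω => by simpa using hle ω)) hi hle
    _ = _ := by rw [integral_add (hb.indicator hS) hc, integral_indicator hS]

lemma abs_integral_sub_one_mul_comp_le {Ω : Type*} [MeasurableSpace Ω] {μ : Measure Ω}
    [IsProbabilityMeasure μ] {H Y : Ω → ℝ} (hH : Integrable H μ) (hY : Measurable Y)
    {φ : ℝ → ℝ} (hφ : Measurable φ) (hφ1 : ∀ x, |φ x| ≤ 1) :
    |∫ ω, (H ω - 1) * φ (Y ω) ∂μ|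
      ≤ ∫ ω, |(μ[H | MeasurableSpace.comap Y inferInstance]) ω - 1| ∂μ := by
  have hm := hY.comap_le
  have hφY : StronglyMeasurable[MeasurableSpace.comap Y inferInstance] (fun ω => φ (Y ω)) :=
    (hφ.comp (comap_measurable Y)).stronglyMeasurable
  have hφi : Integrable (fun ω => φ (Y ω)) μ :=
    (integrable_const (1 : ℝ)).mono' (hφ.comp hY).aestronglyMeasurable
      (.of_forall fun ω => hφ1 _)
  have hHφ : Integrable (H * fun ω => φ (Y ω)) μ :=
    hH.mul_bdd (c := 1) (hφ.comp hY).aestronglyMeasurable (.of_forall fun ω => hφ1 _)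
  have hCφ : Integrable ((μ[H | MeasurableSpace.comap Y inferInstance]) * fun ω => φ (Y ω)) μ :=
    integrable_condExp.mul_bdd (c := 1) (hφ.comp hY).aestronglyMeasurable
      (.of_forall fun ω => hφ1 _)
  have e1 : ∫ ω, (H * fun ω => φ (Y ω)) ω ∂μ
      = ∫ ω, ((μ[H | MeasurableSpace.comap Y inferInstance]) * fun ω => φ (Y ω)) ω ∂μ := by
    rw [← integral_condExp hm]
    exact integral_congr_ae (condExp_mul_of_stronglyMeasurable_right hφY hHφ hH)
  have e2 : ∫ ω, (H ω - 1) * φ (Y ω) ∂μ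
      = ∫ ω, ((μ[H | MeasurableSpace.comap Y inferInstance]) ω - 1) * φ (Y ω) ∂μ := by
    simp only [sub_mul, one_mul]
    exact (integral_sub hHφ hφi).trans
      ((congrArg (· - _) e1).trans (integral_sub hCφ hφi).symm)
  rw [e2]
  refine abs_integral_le_integral_abs.trans (integral_mono_of_nonneg
    (.of_forall fun ω => abs_nonneg _) (integrable_condExp.sub (integrable_const _)).abs
    (.of_forall fun ω => ?_))
  simp only [abs_mul]
  exact mul_le_of_le_one_right (abs_nonneg _) (hφ1 _)

lemma abs_integral_le_iSup_lipschitz {Ω : Type*} [MeasurableSpace Ω] {μ : Measure Ω}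
    [IsProbabilityMeasure μ] {W W' G : Ω → ℝ}
    (hGD : Integrable (fun ω => G ω * (W' ω - W ω)) μ)
    {f : ℝ → ℝ} (hf : LipschitzWith 1 f ∧ (∀ x, |f x| ≤ 1) ∧ f 0 = 0) :
    |∫ ω, (G ω * f (W' ω) - G ω * f (W ω) - f (W ω)) ∂μ|
      ≤ ⨆ f : {f : ℝ → ℝ // LipschitzWith 1 f ∧ (∀ x, |f x| ≤ 1) ∧ f 0 = 0},
        |∫ ω, (G ω * f.1 (W' ω) - G ω * f.1 (W ω) - f.1 (W ω)) ∂μ| := by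
  refine le_ciSup (f := fun f : {f : ℝ → ℝ // LipschitzWith 1 f ∧ (∀ x, |f x| ≤ 1) ∧ f 0 = 0} =>
    |∫ ω, (G ω * f.1 (W' ω) - G ω * f.1 (W ω) - f.1 (W ω)) ∂μ|)
    ⟨∫ ω, (|G ω * (W' ω - W ω)| + 1) ∂μ, ?_⟩ ⟨f, hf⟩
  rintro _ ⟨⟨f, hf, hf1, -⟩, rfl⟩
  refine abs_integral_le_integral_abs.trans (integral_mono_of_nonneg
    (.of_forall fun ω => abs_nonneg _) (hGD.abs.add (integrable_const _))
    (.of_forall fun ω => ?_))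
  have h1 := hf.dist_le_mul (W' ω) (W ω)
  simp only [Real.dist_eq, NNReal.coe_one, one_mul] at h1
  calc |G ω * f (W' ω) - G ω * f (W ω) - f (W ω)|
      = |G ω * (f (W' ω) - f (W ω)) - f (W ω)| := by ring_nf
    _ ≤ |G ω * (f (W' ω) - f (W ω))| + |f (W ω)| := abs_sub _ _
    _ ≤ |G ω * (W' ω - W ω)| + 1 := by
      rw [abs_mul, abs_mul]
      gcongr
      exact hf1 _

/-- The kernel controlling the effect of the jump of `steinDeriv`. -/
def jumpKernel (α β β' s : ℝ) : ℝ :=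
  (1 + α * β) * (Icc (-β') β').indicator 1 s + α * max (β - |s|) 0

lemma jumpKernel_nonneg {α β : ℝ} (hα : 0 ≤ α) (hβ : 0 ≤ β) (β' s : ℝ) :
    0 ≤ jumpKernel α β β' s := by
  have : 0 ≤ (Icc (-β') β').indicator (1 : ℝ → ℝ) s :=
    indicator_nonneg (fun _ _ => zero_le_one) _
  unfold jumpKernel
  positivity

lemma measurable_jumpKernel (α β β' : ℝ) : Measurable (jumpKernel α β β') := by
  have : Measurable ((Icc (-β') β').indicator (1 : ℝ → ℝ)) :=
    measurable_one.indicator measurableSet_Icc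
  unfold jumpKernel
  fun_prop

lemma lintegral_jumpKernel {α β β' : ℝ} (hα : 0 ≤ α) (hβ : 0 ≤ β) (hβ' : 0 ≤ β') :
    ∫⁻ s, ENNReal.ofReal (jumpKernel α β β' s)
      ≤ ENNReal.ofReal (2 * (1 + α * β) * β' + α * β ^ 2) := by
  have hm1 : Measurable ((Icc (-β') β').indicator (1 : ℝ → ENNReal)) :=
    measurable_one.indicator measurableSet_Icc
  have hm : Measurable fun s : ℝ => ENNReal.ofReal (max (β - |s|) 0) := by fun_prop
  have hcont : Continuous fun s : ℝ => max (β - |s|) 0 := by fun_prop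
  have h2 : ∫⁻ s, ENNReal.ofReal (max (β - |s|) 0) = ENNReal.ofReal (β ^ 2) := by
    have hsupp : ∀ s : ℝ, s ∉ Ioc (-β) β → max (β - |s|) 0 = 0 := fun s hs => by
      refine max_eq_right ?_
      rw [mem_Ioc, not_and_or, not_lt, not_le] at hs
      rcases hs with hs | hs
      · linarith [neg_le_abs s]
      · linarith [le_abs_self s]
    have e : (fun s => max (β - |s|) 0) = (Ioc (-β) β).indicator fun s => max (β - |s|) 0 := by
      ext s
      by_cases h : s ∈ Ioc (-β) β
      · rw [indicator_of_mem h]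
      · rw [indicator_of_notMem h, hsupp s h]
    have hi : Integrable (fun s : ℝ => max (β - |s|) 0) := by
      rw [e, integrable_indicator_iff measurableSet_Ioc]
      exact hcont.integrableOn_Ioc
    rw [← ofReal_integral_eq_lintegral_ofReal hi (.of_forall fun s => le_max_right _ _), e,
      integral_indicator measurableSet_Ioc,
      ← intervalIntegral.integral_of_le (by linarith),
      ← intervalIntegral.integral_add_adjacent_intervals (b := 0)
        (hcont.intervalIntegrable _ _) (hcont.intervalIntegrable _ _)]
    have e1 : ∫ s in (-β)..0, max (β - |s|) 0 = ∫ s in (-β)..0, (β + s) := by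
      refine intervalIntegral.integral_congr fun s hs => ?_
      rw [uIcc_of_le (by linarith)] at hs
      rw [abs_of_nonpos hs.2, max_eq_left (by linarith [hs.1])]
      ring
    have e2 : ∫ s in 0..β, max (β - |s|) 0 = ∫ s in 0..β, (β - s) := by
      refine intervalIntegral.integral_congr fun s hs => ?_
      rw [uIcc_of_le (by linarith)] at hs
      rw [abs_of_nonneg hs.1, max_eq_left (by linarith [hs.2])]
    rw [e1, e2, intervalIntegral.integral_add (by simp) (by simp),
      intervalIntegral.integral_sub (by simp) (by simp)]
    simp
    ring_nf
  have e : ∀ s, ENNReal.ofReal (jumpKernel α β β' s)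
      = ENNReal.ofReal (1 + α * β) * (Icc (-β') β').indicator 1 s
        + ENNReal.ofReal α * ENNReal.ofReal (max (β - |s|) 0) := fun s => by
    unfold jumpKernel
    have h0 : 0 ≤ (Icc (-β') β').indicator (1 : ℝ → ℝ) s :=
      indicator_nonneg (fun _ _ => zero_le_one) _
    rw [ENNReal.ofReal_add (by positivity) (by positivity), ENNReal.ofReal_mul (by positivity),
      ENNReal.ofReal_mul hα]
    congr 2
    by_cases h : s ∈ Icc (-β') β' <;> simp [h]
  simp only [e]
  rw [lintegral_add_left (by fun_prop), lintegral_const_mul _ hm1, lintegral_const_mul _ hm,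
    lintegral_indicator_one measurableSet_Icc, h2, Real.volume_Icc,
    ← ENNReal.ofReal_mul (by positivity), ← ENNReal.ofReal_mul hα,
    ← ENNReal.ofReal_add (by nlinarith [mul_nonneg hα hβ]) (by positivity)]
  exact ENNReal.ofReal_le_ofReal (by nlinarith)

lemma integrable_jumpKernel_comp {Ω : Type*} [MeasurableSpace Ω] {μ : Measure Ω}
    [IsProbabilityMeasure μ] {W : Ω → ℝ} (hW : Measurable W) {α β β' : ℝ} (hα : 0 ≤ α)
    (hβ : 0 ≤ β) (z : ℝ) : Integrable (fun ω => jumpKernel α β β' (z - W ω)) μ := by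
  refine (integrable_const ((1 + α * β) * 1 + α * β)).mono'
    ((measurable_jumpKernel α β β').comp (measurable_const.sub hW)).aestronglyMeasurable
    (.of_forall fun ω => ?_)
  rw [Real.norm_of_nonneg (jumpKernel_nonneg hα hβ _ _)]
  unfold jumpKernel
  gcongr
  · exact indicator_apply_le' (fun _ => le_rfl) (fun _ => zero_le_one)
  · exact max_le (by linarith [abs_nonneg (z - W ω)]) hβ

lemma abs_cdf_sub_le {Ω : Type*} [MeasurableSpace Ω] {μ : Measure Ω} [IsProbabilityMeasure μ]
    {W W' W'' G : Ω → ℝ}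
    (hW : Measurable W) (hW' : Measurable W') (hW'' : Measurable W'') (hG : Measurable G)
    (hGint : Integrable G μ) (hGD : Integrable (fun ω => G ω * (W' ω - W ω)) μ)
    {α β β' : ℝ} (hα : 0 ≤ α) (hβ : 0 ≤ β) (hβ' : 0 ≤ β') {z : ℝ} (hz : 0 ≤ z) :
    |(μ (W ⁻¹' Iic z)).toReal - (1 - Real.exp (-z))|
      ≤ (⨆ f : {f : ℝ → ℝ // LipschitzWith 1 f ∧ (∀ x, |f x| ≤ 1) ∧ f 0 = 0},
          |∫ ω, (G ω * f.1 (W' ω) - G ω * f.1 (W ω) - f.1 (W ω)) ∂μ|)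
        + ∫ ω, |(μ[fun ω => G ω * (W' ω - W ω) | MeasurableSpace.comap W'' inferInstance]) ω
            - 1| ∂μ
        + ∫ ω in {ω | α < |G ω| ∨ β < |W' ω - W ω|}, |G ω * (W' ω - W ω)| ∂μ
        + ∫ ω in {ω | α < |G ω| ∨ β < |W' ω - W ω| ∨ β' < |W'' ω - W ω|},
            |1 - G ω * (W' ω - W ω)| ∂μ
        + (1 + α * β) * β' + α * β ^ 2 + ∫ ω, jumpKernel α β β' (z - W ω) ∂μ := by
  have hfm : Measurable (steinSol z) := (lipschitzWith_steinSol z).continuous.measurable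
  have hgm := measurable_steinDeriv z
  have hg1 : ∀ x, |steinDeriv z x| ≤ 1 := fun x => by
    rw [abs_of_nonneg (steinDeriv_nonneg z x)]; exact steinDeriv_le_one z x
  have hfb : ∀ {X : Ω → ℝ}, Measurable X → ∀ {H : Ω → ℝ}, Integrable H μ →
      Integrable (fun ω => H ω * steinSol z (X ω)) μ := fun hX _ hH =>
    hH.mul_bdd (c := 1) (hfm.comp hX).aestronglyMeasurable
      (.of_forall fun ω => abs_steinSol_le_one hz _)
  have hgb : ∀ {X : Ω → ℝ}, Measurable X → ∀ {H : Ω → ℝ}, Integrable H μ →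
      Integrable (fun ω => H ω * steinDeriv z (X ω)) μ := fun hX _ hH =>
    hH.mul_bdd (c := 1) (hgm.comp hX).aestronglyMeasurable (.of_forall fun ω => hg1 _)
  have h1i : Integrable (fun _ : Ω => (1 : ℝ)) μ := integrable_const _
  have hfW : Integrable (fun ω => steinSol z (W ω)) μ := by simpa using hfb hW h1i
  have hGD1 : Integrable (fun ω => G ω * (W' ω - W ω) - 1) μ := hGD.sub h1i
  have h1GD : Integrable (fun ω => 1 - G ω * (W' ω - W ω)) μ := h1i.sub hGD
  have i1 : Integrable (fun ω => G ω * steinSol z (W' ω) - G ω * steinSol z (W ω)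
      - steinSol z (W ω)) μ := ((hfb hW' hGint).sub (hfb hW hGint)).sub hfW
  have i2 := hgb hW'' hGD1
  have i3 : Integrable (fun ω => G ω * (steinSol z (W' ω) - steinSol z (W ω)
      - (W' ω - W ω) * steinDeriv z (W ω))) μ := by
    convert ((hfb hW' hGint).sub (hfb hW hGint)).sub (hgb hW hGD) using 2
    simp only [Pi.sub_apply]; ring
  have i4 : Integrable (fun ω => (1 - G ω * (W' ω - W ω))
      * (steinDeriv z (W ω) - steinDeriv z (W'' ω))) μ := by
    convert (hgb hW h1GD).sub (hgb hW'' h1GD) using 2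
    simp only [Pi.sub_apply]; ring
  have key : (μ (W ⁻¹' Iic z)).toReal - (1 - Real.exp (-z))
      = ∫ ω, (G ω * steinSol z (W' ω) - G ω * steinSol z (W ω) - steinSol z (W ω)) ∂μ
        - ∫ ω, (G ω * (W' ω - W ω) - 1) * steinDeriv z (W'' ω) ∂μ
        - ∫ ω, G ω * (steinSol z (W' ω) - steinSol z (W ω)
            - (W' ω - W ω) * steinDeriv z (W ω)) ∂μ
        + ∫ ω, (1 - G ω * (W' ω - W ω)) * (steinDeriv z (W ω) - steinDeriv z (W'' ω)) ∂μ := by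
    refine Eq.trans ?_ (integral_add ((i1.sub i2).sub i3) i4 |>.trans
      (congrArg (· + _) ((integral_sub (i1.sub i2) i3).trans
        (congrArg (· - _) (integral_sub i1 i2)))))
    have hset : MeasurableSet (W ⁻¹' Iic z) := hW measurableSet_Iic
    have e : (μ (W ⁻¹' Iic z)).toReal - (1 - Real.exp (-z))
        = ∫ ω, ((W ⁻¹' Iic z).indicator 1 ω - (1 - Real.exp (-z))) ∂μ := by
      rw [integral_sub (f := (W ⁻¹' Iic z).indicator 1) (h1i.indicator hset) (integrable_const _),
        integral_indicator_one hset]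
      simp [Measure.real]
    rw [e]
    refine integral_congr_ae (.of_forall fun ω => ?_)
    have := steinDeriv_sub_steinSol z (W ω)
    have e2 : (W ⁻¹' Iic z).indicator (1 : Ω → ℝ) ω = (Iic z).indicator 1 (W ω) := rfl
    simp only [e2, ← this, Pi.sub_apply]
    ring
  have b1 := abs_integral_le_iSup_lipschitz hGD (f := steinSol z)
    ⟨lipschitzWith_steinSol z, abs_steinSol_le_one hz, steinSol_zero hz⟩
  have b2 := abs_integral_sub_one_mul_comp_le hGD hW'' hgm hg1
  have hJm : Measurable fun ω => (Icc (-β') β').indicator (1 : ℝ → ℝ) (z - W ω) :=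
    (measurable_one.indicator measurableSet_Icc).comp (measurable_const.sub hW)
  have hJ0 : ∀ s, 0 ≤ (Icc (-β') β').indicator (1 : ℝ → ℝ) s :=
    indicator_nonneg (fun _ _ => zero_le_one)
  have hJi : Integrable (fun ω => (1 + α * β) * (Icc (-β') β').indicator 1 (z - W ω)) μ := by
    refine (h1i.mono' hJm.aestronglyMeasurable (.of_forall fun ω => ?_)).const_mul _
    rw [Real.norm_of_nonneg (hJ0 _)]
    exact indicator_apply_le' (fun _ => le_rfl) (fun _ => zero_le_one)
  have hMi : Integrable (fun ω => α * max (β - |z - W ω|) 0) μ := by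
    convert (integrable_jumpKernel_comp hW hα hβ z (μ := μ) (β' := β')).sub hJi using 2
    simp [jumpKernel]
  have b3 := abs_integral_le_setIntegral_add (μ := μ)
    (S := {ω | α < |G ω| ∨ β < |W' ω - W ω|})
    (b := fun ω => |G ω * (W' ω - W ω)|)
    (c := fun ω => α * β ^ 2 + α * max (β - |z - W ω|) 0)
    ((measurableSet_lt measurable_const hG.abs).union
      (measurableSet_lt measurable_const (hW'.sub hW).abs))
    i3.aestronglyMeasurable hGD.abs ((integrable_const _).add hMi)
    (fun ω => by positivity)
    (fun ω _ => by
      rw [abs_mul, abs_mul]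
      exact mul_le_mul_of_nonneg_left (abs_steinSol_sub_sub_le_abs _ _ _) (abs_nonneg _))
    (fun ω hω => by
      simp only [mem_ofPred_eq, not_or, not_lt] at hω
      have h := abs_steinSol_sub_sub_le z (W ω) (W' ω - W ω)
      rw [add_sub_cancel] at h
      rw [abs_mul, ← mul_add]
      refine mul_le_mul hω.1 (h.trans ?_) (abs_nonneg _) hα
      rw [← sq_abs]
      gcongr
      · exact hω.2
      · exact hω.2)
  have b4 := abs_integral_le_setIntegral_add (μ := μ)
    (S := {ω | α < |G ω| ∨ β < |W' ω - W ω| ∨ β' < |W'' ω - W ω|})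
    (b := fun ω => |1 - G ω * (W' ω - W ω)|)
    (c := fun ω => (1 + α * β) * β' + (1 + α * β) * (Icc (-β') β').indicator 1 (z - W ω))
    ((measurableSet_lt measurable_const hG.abs).union
      ((measurableSet_lt measurable_const (hW'.sub hW).abs).union
        (measurableSet_lt measurable_const (hW''.sub hW).abs)))
    i4.aestronglyMeasurable h1GD.abs ((integrable_const _).add hJi)
    (fun ω => by have := hJ0 (z - W ω); positivity)
    (fun ω _ => by
      rw [abs_mul]
      exact mul_le_of_le_one_right (abs_nonneg _) (abs_steinDeriv_sub_le_one _ _ _))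
    (fun ω hω => by
      simp only [mem_ofPred_eq, not_or, not_lt] at hω
      rw [abs_mul, ← mul_add]
      refine mul_le_mul ?_ (abs_steinDeriv_sub_le hω.2.2) (abs_nonneg _) (by positivity)
      refine (abs_sub _ _).trans ?_
      rw [abs_one, abs_mul]
      gcongr
      · exact hω.1
      · exact hω.2.1)
  rw [integral_add (integrable_const _) hMi] at b3
  rw [integral_add (integrable_const _) hJi] at b4
  simp only [integral_const, probReal_univ, one_smul] at b3 b4
  have eJ : ∫ ω, jumpKernel α β β' (z - W ω) ∂μ
      = ∫ ω, (1 + α * β) * (Icc (-β') β').indicator 1 (z - W ω) ∂μ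
        + ∫ ω, α * max (β - |z - W ω|) 0 ∂μ := integral_add hJi hMi
  rw [key, eJ]
  rw [abs_le] at *
  constructor <;> linarith

lemma expMeasure_one_Iic_toReal (z : ℝ) :
    (expMeasure 1 (Iic z)).toReal = if 0 ≤ z then 1 - Real.exp (-z) else 0 := by
  have := isProbabilityMeasure_expMeasure one_pos
  have h := cdf_expMeasure_eq one_pos z
  rwa [cdf_eq_real, one_mul] at h

lemma expMeasure_one_Iic_sub_le {x y : ℝ} (h : x ≤ y) :
    (expMeasure 1 (Iic y)).toReal - (expMeasure 1 (Iic x)).toReal ≤ y - x := by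
  rw [expMeasure_one_Iic_toReal, expMeasure_one_Iic_toReal]
  split_ifs with h1 h2 h2
  · have := exp_neg_sub_exp_neg_le h2 h
    linarith
  · have := Real.add_one_le_exp (-y)
    linarith
  · linarith
  · linarith

lemma le_of_forall_le_integral {Ω : Type*} [MeasurableSpace Ω] {μ : Measure Ω}
    [IsProbabilityMeasure μ] {W : Ω → ℝ} (hW : Measurable W) {α β β' ε κ : ℝ} (hα : 0 ≤ α)
    (hβ : 0 ≤ β) (hβ' : 0 ≤ β') (hε : 0 ≤ ε) (hκ : 0 ≤ κ)
    (hc : ∀ a, (μ (W ⁻¹' Ioc a (a + ε))).toReal ≤ ε + 2 * κ) {y c : ℝ}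
    (h : ∀ z ∈ Ioc y (y + ε), c ≤ ∫ ω, jumpKernel α β β' (z - W ω) ∂μ) :
    c * ε ≤ (2 * (1 + α * β) * β' + α * β ^ 2) * (ε + 2 * κ) := by
  have h1 : ∫⁻ _ in Ioc y (y + ε), ENNReal.ofReal c
      ≤ ∫⁻ z in Ioc y (y + ε), ∫⁻ ω, ENNReal.ofReal (jumpKernel α β β' (z - W ω)) ∂μ := by
    refine setLIntegral_mono' measurableSet_Ioc fun z hz => ?_
    rw [← ofReal_integral_eq_lintegral_ofReal (integrable_jumpKernel_comp hW hα hβ z)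
      (.of_forall fun ω => jumpKernel_nonneg hα hβ _ _)]
    exact ENNReal.ofReal_le_ofReal (h z hz)
  have h2 := lintegral_lintegral_sub_le μ hW (measurable_jumpKernel α β β').ennreal_ofReal
    (fun a => (ENNReal.le_ofReal_iff_toReal_le (measure_ne_top _ _) (by positivity)).2 (hc a)) y
  have h3 := (h1.trans h2).trans (mul_le_mul_left (lintegral_jumpKernel hα hβ hβ') _)
  rw [setLIntegral_const, Real.volume_Ioc, add_sub_cancel_left, ← ENNReal.ofReal_mul' hε,
    ← ENNReal.ofReal_mul (by positivity)] at h3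
  exact (ENNReal.ofReal_le_ofReal_iff (by positivity)).1 h3

theorem kolmogorov_bound_stein_coupling
    {Ω : Type*} [MeasurableSpace Ω] (μ : Measure Ω) [IsProbabilityMeasure μ]
    (W W' W'' G : Ω → ℝ)
    (hW : Measurable W) (hW' : Measurable W') (hW'' : Measurable W'') (hG : Measurable G)
    (hWnonneg : ∀ ω, 0 ≤ W ω)
    (hWint : Integrable W μ) (hW'int : Integrable W' μ)
    (hW''int : Integrable W'' μ) (hGint : Integrable G μ)
    (D D' : Ω → ℝ)
    (hD : D = fun ω => W' ω - W ω) (hD' : D' = fun ω => W'' ω - W ω)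
    (hGD : Integrable (fun ω => G ω * D ω) μ)
    (hGD' : Integrable (fun ω => G ω * D' ω) μ)
    (r1BW r2 : ℝ)
    (hr1 : r1BW = ⨆ f : {f : ℝ → ℝ // LipschitzWith 1 f ∧ (∀ x, |f x| ≤ 1) ∧ f 0 = 0},
      |∫ ω, (G ω * f.1 (W' ω) - G ω * f.1 (W ω) - f.1 (W ω)) ∂μ|)
    (hr2 : r2 = ∫ ω, |(μ[fun ω => G ω * D ω | MeasurableSpace.comap W'' inferInstance]) ω - 1| ∂μ)
    (α β β' : ℝ) (hα : 0 < α) (hβ : 0 < β) (hβ' : 0 < β')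
    (r5 r5' : ℝ)
    (hr5 : r5 = ∫ ω in {ω | α < |G ω| ∨ β < |D ω|}, |G ω * D ω| ∂μ)
    (hr5' : r5' = ∫ ω in {ω | α < |G ω| ∨ β < |D ω| ∨ β' < |D' ω|}, |1 - G ω * D ω| ∂μ) :
    dK (Measure.map W μ) (expMeasure 1)
      ≤ 2 * r1BW + 2 * r2 + 2 * r5 + 2 * r5'
        + 22 * (α * β + 1) * β' + 12 * α * β ^ 2 := by
  subst hD hD'
  simp only at hGD hr2 hr5 hr5'
  have := isProbabilityMeasure_expMeasure one_pos
  have hWp : IsProbabilityMeasure (μ.map W) := Measure.isProbabilityMeasure_map hW.aemeasurable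
  set F : ℝ → ℝ := fun z => ((μ.map W) (Iic z)).toReal with hF
  set E : ℝ → ℝ := fun z => (expMeasure 1 (Iic z)).toReal with hE
  have hF0 : ∀ z, 0 ≤ F z := fun z => ENNReal.toReal_nonneg
  have hE0 : ∀ z, 0 ≤ E z := fun z => ENNReal.toReal_nonneg
  have hF1 : ∀ z, F z ≤ 1 := fun z => measureReal_le_one
  have hE1 : ∀ z, E z ≤ 1 := fun z => measureReal_le_one
  have hFmono : ∀ x y, x ≤ y → F x ≤ F y := fun x y h => measureReal_mono (Iic_subset_Iic.2 h)
  set κ := dK (μ.map W) (expMeasure 1) with hκ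
  have hle : ∀ z, |F z - E z| ≤ κ := fun z => by
    refine le_ciSup (f := fun z => |F z - E z|) ⟨1, ?_⟩ z
    rintro _ ⟨z, rfl⟩
    exact abs_le.2 ⟨by linarith [hF0 z, hE1 z], by linarith [hE0 z, hF1 z]⟩
  have hκ0 : 0 ≤ κ := (abs_nonneg _).trans (hle 0)
  have hr1n : 0 ≤ r1BW := hr1 ▸ Real.iSup_nonneg fun _ => abs_nonneg _
  have hr2n : 0 ≤ r2 := hr2 ▸ integral_nonneg fun _ => abs_nonneg _
  have hr5n : 0 ≤ r5 := hr5 ▸ integral_nonneg fun _ => abs_nonneg _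
  have hr5n' : 0 ≤ r5' := hr5' ▸ integral_nonneg fun _ => abs_nonneg _
  set A := (1 + α * β) * β' with hA
  set B := α * β ^ 2 with hB
  have hA0 : 0 < A := by positivity
  have hB0 : 0 < B := by positivity
  set ε := 8 * A + 4 * B with hε
  have hε0 : 0 < ε := by positivity
  have hEz : ∀ z, 0 ≤ z → E z = 1 - Real.exp (-z) := fun z hz => by
    simp only [hE, expMeasure_one_Iic_toReal, if_pos hz]
  have hFW : ∀ z, F z = (μ (W ⁻¹' Iic z)).toReal := fun z => by
    simp only [hF, Measure.map_apply hW measurableSet_Iic]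
  have hpt : ∀ z, 0 ≤ z → |F z - E z| ≤ r1BW + r2 + r5 + r5' + A + B
      + ∫ ω, jumpKernel α β β' (z - W ω) ∂μ := fun z hz => by
    rw [hFW, hEz z hz, hr1, hr2, hr5, hr5']
    exact abs_cdf_sub_le hW hW' hW'' hG hGint hGD hα.le hβ.le hβ'.le hz
  have hc : ∀ a, (μ (W ⁻¹' Ioc a (a + ε))).toReal ≤ ε + 2 * κ := fun a => by
    have e : (μ (W ⁻¹' Ioc a (a + ε))).toReal = F (a + ε) - F a := by
      rw [hFW, hFW, ← Iic_sdiff_Iic, preimage_sdiff]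
      exact measureReal_sdiff (preimage_mono (Iic_subset_Iic.2 (by linarith)))
        (hW measurableSet_Iic)
    have h1 := abs_le.1 (hle (a + ε))
    have h2 := abs_le.1 (hle a)
    have h3 := expMeasure_one_Iic_sub_le (show a ≤ a + ε by linarith)
    simp only [hE] at h1 h2
    linarith
  have hend : ∀ y c, (∀ z ∈ Ioc y (y + ε), c ≤ ∫ ω, jumpKernel α β β' (z - W ω) ∂μ) →
      c ≤ 2 * A + B + κ / 2 := fun y c h => by
    have h1 := le_of_forall_le_integral hW hα.le hβ.le hβ'.le hε0.le hκ0 hc h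
    refine le_of_mul_le_mul_right (h1.trans (le_of_eq ?_)) hε0
    rw [hε, hA, hB]; ring
  have hfin : ∀ z, |F z - E z| ≤ r1BW + r2 + r5 + r5' + 11 * A + 6 * B + κ / 2 := fun z => by
    rcases lt_or_ge z 0 with hz | hz
    · have e1 : F z = 0 := by
        have : W ⁻¹' Iic z = ∅ := by
          ext ω
          simp only [mem_preimage, mem_Iic, mem_empty_iff_false, iff_false, not_le]
          linarith [hWnonneg ω]
        rw [hFW, this]; simp
      have e2 : E z = 0 := by simp only [hE, expMeasure_one_Iic_toReal, if_neg (not_le.2 hz)]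
      rw [e1, e2, sub_zero, abs_zero]
      positivity
    rw [abs_le]
    constructor
    · rcases lt_or_ge z ε with hzε | hzε
      · have h1 := Real.add_one_le_exp (-z)
        have h2 := hEz z hz
        linarith [hF0 z]
      · have := hend (z - ε) (E z - F z - ε - (r1BW + r2 + r5 + r5' + A + B)) fun x hx => by
          rw [mem_Ioc] at hx
          have h1 := (abs_le.1 (hpt x (by linarith))).1
          have h2 := hFmono x z (by linarith)
          have h3 := expMeasure_one_Iic_sub_le (show x ≤ z by linarith)
          simp only [hE] at h1 ⊢
          linarith
        linarith
    · have := hend z (F z - E z - ε - (r1BW + r2 + r5 + r5' + A + B)) fun x hx => by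
        rw [mem_Ioc] at hx
        have h1 := (abs_le.1 (hpt x (by linarith))).2
        have h2 := hFmono z x (by linarith)
        have h3 := expMeasure_one_Iic_sub_le (show z ≤ x by linarith)
        simp only [hE] at h1 ⊢
        linarith
      linarith
  have hsup : κ ≤ r1BW + r2 + r5 + r5' + 11 * A + 6 * B + κ / 2 := ciSup_le hfin
  have e1 : 22 * (α * β + 1) * β' = 22 * A := by rw [hA]; ring
  have e2 : 12 * α * β ^ 2 = 12 * B := by rw [hB]; ring
  linarith

end
end

section
/- Let (X_t)_{t≥0} be an ergodic (irreducible, aperiodic, positive recurrent) stationary Markov chain on a countable state space with transition matrix P and stationary distribution π, and fix a state i with π_i > 0. Let T_{π,i} be distributed as inf{t ≥ 0 : X_t = i} when X_0 ~ π, and let T_{i,i} be distributed as inf{t > 0 : X_t = i} when X_0 = i, with T_{π,i} and T_{i,i} coupled arbitrarily on a common probability space. Then d_K(L(π_i T_{π,i}), Exp(1)) ≤ 2 π_i + P(T_{π,i} ≠ T_{i,i}). -/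
open MeasureTheory ProbabilityTheory Set

noncomputable section

open Classical in
/-- `n`-step transition probabilities associated with a transition matrix `P`. -/
def matPow {S : Type*} (P : S → S → ℝ) : ℕ → S → S → ℝ
  | 0 => fun s t => if s = t then 1 else 0
  | (n + 1) => fun s t => ∑' u : S, matPow P n s u * P u t

/-- `X` is a (time homogeneous) Markov chain with transition matrix `P`:
all cylinder events based on singletons are measurable, and the conditional
probability of `{X (n+1) = j}` given the past, on any cylinder event, is `P (X n) j`. -/
def IsMarkovChain {S Ω : Type*} [MeasurableSpace Ω] (μ : Measure Ω)
    (X : ℕ → Ω → S) (P : S → S → ℝ) : Prop :=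
  (∀ n (j : S), MeasurableSet {ω | X n ω = j}) ∧
  ∀ (n : ℕ) (s : ℕ → S) (j : S),
    μ ({ω | ∀ k ≤ n, X k ω = s k} ∩ {ω | X (n + 1) ω = j})
      = ENNReal.ofReal (P (s n) j) * μ {ω | ∀ k ≤ n, X k ω = s k}

section

variable {S Ω : Type*}

/-- The event that `X` does not visit `i` at the `n` times `m, …, m + n - 1`. -/
def avoidSet (X : ℕ → Ω → S) (i : S) (m n : ℕ) : Set Ω :=
  {ω | ∀ k < n, X (m + k) ω ≠ i}

lemma antitone_avoidSet (X : ℕ → Ω → S) (i : S) (m : ℕ) : Antitone (avoidSet X i m) :=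
  fun _ _ h _ hω k hk => hω k (hk.trans_le h)

lemma mem_avoidSet_succ {X : ℕ → Ω → S} {i : S} {m n : ℕ} {ω : Ω} :
    ω ∈ avoidSet X i m (n + 1) ↔ X m ω ≠ i ∧ ω ∈ avoidSet X i (m + 1) n := by
  constructor
  · intro h
    refine ⟨h 0 n.succ_pos, fun k hk => ?_⟩
    rw [show m + 1 + k = m + (k + 1) by omega]
    exact h (k + 1) (by omega)
  · rintro ⟨h0, h⟩ k hk
    rcases k with _ | k
    · exact h0
    · rw [show m + (k + 1) = m + 1 + k by omega]
      exact h k (by omega)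

lemma sInf_eq_succ_iff_mem_sdiff (X : ℕ → Ω → S) (i : S) (k : ℕ) (ω : Ω) :
    sInf {t : ℕ | X t ω = i} = k + 1 ↔
      ω ∈ avoidSet X i 0 (k + 1) \ avoidSet X i 0 (k + 2) := by
  simp only [avoidSet, zero_add, mem_sdiff, mem_ofPred_eq, not_forall, not_not]
  constructor
  · intro h
    have hne : {t : ℕ | X t ω = i}.Nonempty := Nat.nonempty_of_sInf_eq_succ h
    refine ⟨fun j hj hji => Nat.notMem_of_lt_sInf (h ▸ hj) hji, k + 1, by omega, ?_⟩
    have := Nat.sInf_mem hne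
    rwa [h] at this
  · rintro ⟨h, j, hj, hji⟩
    have hjk : j = k + 1 := by
      by_contra hne
      exact h j (by omega) hji
    subst hjk
    refine le_antisymm (Nat.sInf_le hji) (le_csInf ⟨_, hji⟩ fun b hb => ?_)
    by_contra hlt
    exact h b (by omega) hb

lemma lt_sInf_iff_mem_avoidSet {Y : ℕ → Ω → S} {i : S} {ω : Ω}
    (hne : {t : ℕ | 0 < t ∧ Y t ω = i}.Nonempty) (k : ℕ) :
    k < sInf {t : ℕ | 0 < t ∧ Y t ω = i} ↔ ω ∈ avoidSet Y i 1 k := by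
  simp only [avoidSet, mem_ofPred_eq]
  constructor
  · intro h j hj hji
    have hlt : 1 + j < sInf {t : ℕ | 0 < t ∧ Y t ω = i} := by omega
    exact Nat.notMem_of_lt_sInf hlt ⟨by omega, hji⟩
  · intro h
    obtain ⟨hpos, hmem⟩ := Nat.sInf_mem hne
    by_contra hle
    refine h (sInf {t : ℕ | 0 < t ∧ Y t ω = i} - 1) (by omega) ?_
    rwa [Nat.add_sub_cancel' hpos]

/-- The probability that a chain with transition matrix `P` avoids `i` during its next `n` steps,
as a function of its current state. -/
def avoidProb (P : S → S → ℝ) (i : S) : ℕ → S → ENNReal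
  | 0 => fun _ => 1
  | (n + 1) => fun s => ∑' t, ({i}ᶜ : Set S).indicator
      (fun t => avoidProb P i n t * ENNReal.ofReal (P s t)) t

variable [MeasurableSpace Ω] {μ : Measure Ω}

lemma measure_eq_tsum_inter_fiber [Countable S] {f : Ω → S}
    (hf : ∀ t, MeasurableSet {ω | f ω = t}) {A : Set Ω} (hA : MeasurableSet A) :
    μ A = ∑' t, μ ({ω | f ω = t} ∩ A) := by
  rw [← measure_iUnion _ (fun t => (hf t).inter hA)]
  · congr 1
    ext ω
    simp
  · intro s t hst
    refine Set.disjoint_left.2 ?_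
    rintro ω ⟨hs, -⟩ ⟨ht, -⟩
    exact hst (hs.symm.trans ht)

lemma measurableSet_avoidSet {X : ℕ → Ω → S} (hX : ∀ n j, MeasurableSet {ω | X n ω = j})
    (i : S) (m n : ℕ) : MeasurableSet (avoidSet X i m n) := by
  have : avoidSet X i m n = ⋂ k, ⋂ (_ : k < n), {ω | X (m + k) ω = i}ᶜ := by
    ext ω
    simp [avoidSet]
  rw [this]
  exact MeasurableSet.iInter fun k => MeasurableSet.iInter fun _ => (hX _ _).compl

lemma measure_inter_avoidSet_succ [Countable S] {X : ℕ → Ω → S}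
    (hX : ∀ n j, MeasurableSet {ω | X n ω = j}) (i : S) (m n : ℕ) {A : Set Ω}
    (hA : MeasurableSet A) :
    μ (A ∩ avoidSet X i m (n + 1)) = ∑' t, ({i}ᶜ : Set S).indicator
      (fun t => μ (A ∩ {ω | X m ω = t} ∩ avoidSet X i (m + 1) n)) t := by
  rw [measure_eq_tsum_inter_fiber (hX m) (hA.inter (measurableSet_avoidSet hX i m (n + 1)))]
  refine tsum_congr fun t => ?_
  by_cases ht : t = i
  · rw [Set.indicator_of_notMem (by simpa using ht)]
    convert measure_empty (μ := μ)
    ext ω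
    simp only [mem_inter_iff, mem_ofPred_eq, mem_avoidSet_succ, mem_empty_iff_false, iff_false]
    rintro ⟨h, -, h', -⟩
    exact h' (h.trans ht)
  · rw [Set.indicator_of_mem (by simpa using ht)]
    congr 1
    ext ω
    simp only [mem_inter_iff, mem_ofPred_eq, mem_avoidSet_succ]
    constructor
    · rintro ⟨h, hA, -, h'⟩
      exact ⟨⟨hA, h⟩, h'⟩
    · rintro ⟨⟨hA, h⟩, h'⟩
      exact ⟨h, hA, h ▸ ht, h'⟩

namespace IsMarkovChain

variable [Countable S] {X : ℕ → Ω → S} {P : S → S → ℝ}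

lemma measure_cylinder_inter_avoidSet (hX : IsMarkovChain μ X P) (i : S) (n : ℕ) :
    ∀ (m : ℕ) (s : ℕ → S),
      μ ({ω | ∀ k ≤ m, X k ω = s k} ∩ avoidSet X i (m + 1) n)
        = avoidProb P i n (s m) * μ {ω | ∀ k ≤ m, X k ω = s k} := by
  induction n with
  | zero => intro m s; simp [avoidSet, avoidProb]
  | succ n ih =>
    intro m s
    have hcyl : MeasurableSet {ω | ∀ k ≤ m, X k ω = s k} := by
      simp only [ofPred_forall]
      exact MeasurableSet.iInter fun k => MeasurableSet.iInter fun _ => hX.1 _ _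
    rw [measure_inter_avoidSet_succ hX.1 i (m + 1) n hcyl, avoidProb, ← ENNReal.tsum_mul_right]
    refine tsum_congr fun t => ?_
    by_cases ht : t ∈ ({i}ᶜ : Set S)
    · rw [Set.indicator_of_mem ht, Set.indicator_of_mem ht]
      have hext : {ω | ∀ k ≤ m, X k ω = s k} ∩ {ω | X (m + 1) ω = t}
          = {ω | ∀ k ≤ m + 1, X k ω = Function.update s (m + 1) t k} := by
        ext ω
        simp only [mem_inter_iff, mem_ofPred_eq]
        constructor
        · rintro ⟨h, h'⟩ k hk
          rcases Nat.le_succ_iff.1 hk with hk | rfl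
          · rw [Function.update_of_ne (by omega)]
            exact h k hk
          · simpa using h'
        · intro h
          refine ⟨fun k hk => ?_, by simpa using h (m + 1) le_rfl⟩
          have := h k (by omega)
          rwa [Function.update_of_ne (by omega)] at this
      rw [hext, ih (m + 1), ← hext, hX.2, Function.update_self, mul_assoc]
    · rw [Set.indicator_of_notMem ht, Set.indicator_of_notMem ht, zero_mul]

lemma measure_zero_inter_avoidSet (hX : IsMarkovChain μ X P) (i s : S) (n : ℕ) :
    μ ({ω | X 0 ω = s} ∩ avoidSet X i 1 n) = avoidProb P i n s * μ {ω | X 0 ω = s} := by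
  simpa using hX.measure_cylinder_inter_avoidSet i n 0 (fun _ => s)

lemma measure_one_inter_avoidSet (hX : IsMarkovChain μ X P) (i s : S) (n : ℕ) :
    μ ({ω | X 1 ω = s} ∩ avoidSet X i 2 n) = avoidProb P i n s * μ {ω | X 1 ω = s} := by
  rw [measure_eq_tsum_inter_fiber (hX.1 0)
      ((hX.1 1 s).inter (measurableSet_avoidSet hX.1 i 2 n)),
    measure_eq_tsum_inter_fiber (hX.1 0) (hX.1 1 s), ← ENNReal.tsum_mul_left]
  refine tsum_congr fun u => ?_
  have hcyl : {ω | X 0 ω = u} ∩ {ω | X 1 ω = s}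
      = {ω | ∀ k ≤ 1, X k ω = Function.update (fun _ => u) 1 s k} := by
    ext ω
    simp only [mem_inter_iff, mem_ofPred_eq]
    constructor
    · rintro ⟨h, h'⟩ k hk
      interval_cases k <;> simpa
    · intro h
      exact ⟨by simpa using h 0 (by omega), by simpa using h 1 le_rfl⟩
  rw [← inter_assoc, hcyl, hX.measure_cylinder_inter_avoidSet i n 1]
  simp

/-- For a stationary chain, `P(X 0, …, X (n - 1) ≠ i)` drops by `π i` times the probability that
the first return time to `i` exceeds `n` when `n` is increased by one. -/
lemma measure_avoidSet_eq_add (hX : IsMarkovChain μ X P)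
    (hstat : ∀ j, μ {ω | X 1 ω = j} = μ {ω | X 0 ω = j}) (i : S) (n : ℕ) :
    μ (avoidSet X i 0 n)
      = μ (avoidSet X i 0 (n + 1)) + avoidProb P i n i * μ {ω | X 0 ω = i} := by
  have hshift : μ (avoidSet X i 0 n) = μ (avoidSet X i 1 n) := by
    rcases n with _ | n
    · simp [avoidSet]
    · have h0 := measure_inter_avoidSet_succ (μ := μ) hX.1 i 0 n MeasurableSet.univ
      have h1 := measure_inter_avoidSet_succ (μ := μ) hX.1 i 1 n MeasurableSet.univ
      simp only [univ_inter] at h0 h1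
      rw [h0, h1]
      simp only [zero_add, one_add_one_eq_two, hX.measure_zero_inter_avoidSet,
        hX.measure_one_inter_avoidSet, hstat]
  rw [hshift, ← hX.measure_zero_inter_avoidSet,
    ← measure_inter_add_sdiff (avoidSet X i 1 n) (hX.1 0 i), add_comm, inter_comm]
  congr 2
  ext ω
  simp [mem_avoidSet_succ, and_comm]

end IsMarkovChain

lemma abs_sub_inv_one_add_pow_le {p δ : ℝ} (hp : 0 < p) {G H : ℕ → ℝ}
    (hrec : ∀ k, G k - G (k + 1) = p * H (k + 1)) (hGH : ∀ k, |G k - H k| ≤ δ)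
    (h0 : |G 0 - (1 + p)⁻¹| ≤ δ) (k : ℕ) : |G k - ((1 + p) ^ (k + 1))⁻¹| ≤ δ := by
  induction k with
  | zero => simpa using h0
  | succ k ih =>
    have hq : 0 < 1 + p := by linarith
    have hpow : ((1 + p) ^ (k + 1))⁻¹ = (1 + p) * ((1 + p) ^ (k + 1 + 1))⁻¹ := by
      field_simp
      ring
    have h1 := abs_le.1 (hGH (k + 1))
    have h2 := hrec k
    rw [hpow, abs_le] at ih
    rw [abs_le]
    constructor <;> refine le_of_mul_le_mul_left ?_ hq <;> nlinarith

lemma abs_inv_one_add_pow_sub_exp_le {p z : ℝ} (hp : 0 < p) {k : ℕ} (hkz : p * k ≤ z)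
    (hzk : z ≤ p * (k + 1)) : |((1 + p) ^ (k + 1))⁻¹ - Real.exp (-z)| ≤ p := by
  have hq : 0 < 1 + p := by linarith
  have hlow : Real.exp (-(p * (k + 1))) ≤ ((1 + p) ^ (k + 1))⁻¹ := by
    rw [Real.exp_neg]
    refine inv_anti₀ (by positivity) ?_
    have h := pow_le_pow_left₀ hq.le (by linarith [Real.add_one_le_exp p] : 1 + p ≤ Real.exp p)
      (k + 1)
    rw [← Real.exp_nat_mul] at h
    refine h.trans_eq ?_
    push_cast
    ring_nf
  set x : ℝ := p / (1 + p) * (k + 1) with hx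
  have hup : ((1 + p) ^ (k + 1))⁻¹ ≤ Real.exp (-x) := by
    have h1 : (1 + p)⁻¹ ≤ Real.exp (-(p / (1 + p))) := by
      refine le_trans (le_of_eq ?_) (Real.add_one_le_exp _)
      field_simp
      ring
    have h := pow_le_pow_left₀ (by positivity) h1 (k + 1)
    rw [← Real.exp_nat_mul, inv_pow] at h
    refine h.trans_eq ?_
    rw [hx]
    push_cast
    ring_nf
  have hxp : p * (k + 1) = x + x * p := by
    rw [hx]
    field_simp
  have hx0 : 0 ≤ x := by positivity
  rw [abs_le]
  constructor
  · have h1 : Real.exp (-z) * (1 - p) ≤ Real.exp (-(p * (k + 1))) := by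
      calc Real.exp (-z) * (1 - p) ≤ Real.exp (-z) * Real.exp (-p) := by
            gcongr
            exact Real.one_sub_le_exp_neg p
        _ = Real.exp (-z + -p) := (Real.exp_add _ _).symm
        _ ≤ _ := Real.exp_le_exp.2 (by linarith)
    have h2 : Real.exp (-z) ≤ 1 :=
      Real.exp_le_one_iff.2 (by linarith [mul_nonneg hp.le k.cast_nonneg])
    nlinarith
  · have h1 : Real.exp (-x) * (1 - x * p) ≤ Real.exp (-z) := by
      calc Real.exp (-x) * (1 - x * p) ≤ Real.exp (-x) * Real.exp (-(x * p)) := by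
            gcongr
            exact Real.one_sub_le_exp_neg _
        _ = Real.exp (-x + -(x * p)) := (Real.exp_add _ _).symm
        _ ≤ _ := Real.exp_le_exp.2 (by linarith)
    have h2 : Real.exp (-x) * x ≤ 1 := by
      rw [Real.exp_neg, inv_mul_le_one₀ (Real.exp_pos _)]
      linarith [Real.add_one_le_exp x]
    nlinarith

/-- If `R` is almost surely positive and the tail of `T` decreases by `p` times the tail of `R`,
then `p * T` is close to exponential as soon as `p` is small and `T` and `R` agree with high
probability. -/
lemma dK_map_expMeasure_le [IsProbabilityMeasure μ] {T R : Ω → ℕ} (hT : Measurable T) {p : ℝ}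
    (hp : 0 < p) (hp0 : p ≤ μ.real {ω | T ω = 0}) (hR : ∀ᵐ ω ∂μ, 0 < R ω)
    (hTR : ∀ k, μ.real {ω | T ω = k + 1} = p * μ.real {ω | k + 1 < R ω}) :
    dK (μ.map (fun ω => p * (T ω : ℝ))) (expMeasure 1) ≤ p + μ.real {ω | T ω ≠ R ω} := by
  set δ := μ.real {ω | T ω ≠ R ω}
  have hmeas (k : ℕ) : MeasurableSet {ω | T ω = k} := hT (measurableSet_singleton k)
  have hrec (k : ℕ) : μ.real {ω | k < T ω} - μ.real {ω | k + 1 < T ω}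
      = p * μ.real {ω | k + 1 < R ω} := by
    rw [← hTR, sub_eq_iff_eq_add', ← measureReal_union ?_ (hmeas _)]
    · congr 1
      ext ω
      simp only [mem_ofPred_eq, mem_union]
      omega
    · refine Set.disjoint_left.2 fun ω h h' => ?_
      simp only [mem_ofPred_eq] at h h'
      omega
  have hGH (k : ℕ) : |μ.real {ω | k < T ω} - μ.real {ω | k < R ω}| ≤ δ := by
    have h1 : μ.real {ω | k < T ω} ≤ μ.real {ω | k < R ω} + δ := by
      refine le_trans (measureReal_mono ?_) (measureReal_union_le _ _)
      intro ω hω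
      by_cases h : T ω = R ω
      · exact Or.inl (by simpa [← h] using hω)
      · exact Or.inr h
    have h2 : μ.real {ω | k < R ω} ≤ μ.real {ω | k < T ω} + δ := by
      refine le_trans (measureReal_mono ?_) (measureReal_union_le _ _)
      intro ω hω
      by_cases h : T ω = R ω
      · exact Or.inl (by simpa [h] using hω)
      · exact Or.inr h
    rw [abs_le]
    constructor <;> linarith
  have hcompl (k : ℕ) : μ.real {ω | T ω ≤ k} = 1 - μ.real {ω | k < T ω} := by
    have hlt : MeasurableSet {ω | k < T ω} := hT measurableSet_Ioi
    rw [← probReal_compl_eq_one_sub hlt]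
    congr 1
    ext ω
    simp
  have h0 : |μ.real {ω | 0 < T ω} - (1 + p)⁻¹| ≤ δ := by
    have hδ0 : μ.real {ω | T ω = 0} ≤ δ := by
      refine ENNReal.toReal_mono (measure_ne_top _ _) (measure_mono_ae ?_)
      filter_upwards [hR] with ω hω (h : T ω = 0)
      exact (h.trans_lt hω).ne
    have := hcompl 0
    simp only [nonpos_iff_eq_zero] at this
    have h1 : (1 + p)⁻¹ ≤ 1 := inv_le_one_of_one_le₀ (by linarith)
    have h2 : 1 - p ≤ (1 + p)⁻¹ := by
      rw [inv_eq_one_div, le_div_iff₀ (by linarith)]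
      nlinarith
    rw [abs_le]
    constructor <;> linarith [measureReal_nonneg (μ := μ) (s := {ω | T ω = 0})]
  refine ciSup_le fun z => ?_
  have hexp := cdf_expMeasure_eq (r := 1) one_pos z
  have := isProbabilityMeasure_expMeasure (r := 1) one_pos
  rw [cdf_eq_real, measureReal_def] at hexp
  rw [hexp, Measure.map_apply (by fun_prop) measurableSet_Iic, ← measureReal_def]
  split_ifs with hz
  · have hset : (fun ω => p * (T ω : ℝ)) ⁻¹' Iic z = {ω | T ω ≤ ⌊z / p⌋₊} := by
      ext ω
      rw [mem_preimage, mem_Iic, mem_ofPred_eq, Nat.le_floor_iff (by positivity), le_div_iff₀' hp]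
    rw [hset, hcompl]
    have h1 := abs_sub_inv_one_add_pow_le hp (G := fun k => μ.real {ω | k < T ω})
      (H := fun k => μ.real {ω | k < R ω}) hrec hGH h0 ⌊z / p⌋₊
    have h2 := abs_inv_one_add_pow_sub_exp_le hp (z := z) (k := ⌊z / p⌋₊)
      (by rw [← le_div_iff₀' hp]; exact Nat.floor_le (by positivity))
      (by rw [← div_le_iff₀' hp]; exact (Nat.lt_floor_add_one _).le)
    rw [one_mul]
    simp only [abs_le] at *
    constructor <;> linarith
  · have hset : (fun ω => p * (T ω : ℝ)) ⁻¹' Iic z = ∅ := by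
      ext ω
      have : 0 ≤ p * (T ω : ℝ) := by positivity
      simp only [mem_preimage, mem_Iic, mem_empty_iff_false, iff_false]
      linarith
    rw [hset]
    simp only [measureReal_empty, sub_zero, abs_zero]
    positivity

end

theorem kolmogorov_bound_hitting_time_coupling_probability
    {S : Type*} [Countable S]
    {Ω : Type*} [MeasurableSpace Ω] (μ : Measure Ω) [IsProbabilityMeasure μ]
    (P : S → S → ℝ) (π : S → ℝ) (i : S)
    -- `P` is a stochastic matrix:
    (hPnonneg : ∀ s t, 0 ≤ P s t) (hProw : ∀ s, HasSum (P s) 1)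
    -- `π` is a stationary probability distribution (this, together with
    -- irreducibility, expresses positive recurrence):
    (hπnonneg : ∀ s, 0 ≤ π s) (hπsum : HasSum π 1)
    (hπstat : ∀ t, HasSum (fun s => π s * P s t) (π t))
    (hπi : 0 < π i)
    -- the chain is irreducible and aperiodic:
    (hirr : ∀ s t : S, ∃ n : ℕ, 0 < n ∧ 0 < matPow P n s t)
    (haper : ∀ s : S, ∃ N₀ : ℕ, ∀ n ≥ N₀, 0 < matPow P n s s)
    -- `X` is a stationary Markov chain with transition matrix `P`:
    (X : ℕ → Ω → S) (hX : IsMarkovChain μ X P)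
    (hXstat : ∀ (t : ℕ) (j : S), μ {ω | X t ω = j} = ENNReal.ofReal (π j))
    -- `Y` is a Markov chain with transition matrix `P` started at `i`:
    (Y : ℕ → Ω → S) (hY : IsMarkovChain μ Y P) (hY0 : ∀ᵐ ω ∂μ, Y 0 ω = i)
    -- the hitting times:
    (Tπ Tii : Ω → ℕ)
    (hTπ : ∀ ω, Tπ ω = sInf {t : ℕ | X t ω = i})
    (hTii : ∀ ω, Tii ω = sInf {t : ℕ | 0 < t ∧ Y t ω = i}) :
    dK (Measure.map (fun ω => π i * (Tπ ω : ℝ)) μ) (expMeasure 1)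
      ≤ 2 * π i + (μ {ω | Tπ ω ≠ Tii ω}).toReal := by
  have hX0 : μ {ω | X 0 ω = i} = ENNReal.ofReal (π i) := hXstat 0 i
  have hstep (n : ℕ) : μ.real (avoidSet X i 0 n) - μ.real (avoidSet X i 0 (n + 1))
      = π i * μ.real (avoidSet Y i 1 n) := by
    have hYn : μ (avoidSet Y i 1 n) = avoidProb P i n i := by
      have h0 : μ {ω | Y 0 ω = i} = 1 := (mem_ae_iff_prob_eq_one (hY.1 0 i)).1 hY0
      have h := hY.measure_zero_inter_avoidSet i i n
      rw [h0, mul_one] at h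
      rw [← h]
      refine measure_congr ?_
      filter_upwards [hY0] with ω hω
      exact propext ⟨fun h => ⟨hω, h⟩, fun h => h.2⟩
    have h := hX.measure_avoidSet_eq_add (fun j => by rw [hXstat, hXstat]) i n
    rw [hX0, ← hYn] at h
    rw [measureReal_def, h, ENNReal.toReal_add (measure_ne_top _ _)
      (ENNReal.mul_ne_top (measure_ne_top _ _) ENNReal.ofReal_ne_top), ENNReal.toReal_mul,
      ENNReal.toReal_ofReal hπi.le, measureReal_def, measureReal_def]
    ring
  have hreturn : ∀ᵐ ω ∂μ, {t : ℕ | 0 < t ∧ Y t ω = i}.Nonempty := by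
    set b := μ.real {ω | ¬ {t : ℕ | 0 < t ∧ Y t ω = i}.Nonempty}
    have hsub (n : ℕ) : b ≤ μ.real (avoidSet Y i 1 n) := by
      refine measureReal_mono fun ω hω k _ hki => hω ⟨1 + k, by omega, hki⟩
    have hbound (n : ℕ) : μ.real (avoidSet X i 0 n) ≤ 1 - n * (π i * b) := by
      induction n with
      | zero => simp
      | succ n ih =>
        have h1 := hstep n
        have h2 := mul_le_mul_of_nonneg_left (hsub n) hπi.le
        push_cast
        linarith
    have hb0 : b ≤ 0 := by
      by_contra! hpos
      obtain ⟨n, hn⟩ := exists_nat_gt (1 / (π i * b))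
      rw [div_lt_iff₀ (by positivity)] at hn
      have := hbound n
      linarith [measureReal_nonneg (μ := μ) (s := avoidSet X i 0 n)]
    exact (measureReal_eq_zero_iff).1 (le_antisymm hb0 measureReal_nonneg)
  have hTset (k : ℕ) : {ω | Tπ ω = k + 1}
      = avoidSet X i 0 (k + 1) \ avoidSet X i 0 (k + 2) := by
    ext ω
    rw [mem_ofPred_eq, hTπ, sInf_eq_succ_iff_mem_sdiff]
  have hTsucc (k : ℕ) : MeasurableSet {ω | Tπ ω = k + 1} := by
    rw [hTset]
    exact (measurableSet_avoidSet hX.1 _ _ _).diff (measurableSet_avoidSet hX.1 _ _ _)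
  have hTmeas : Measurable Tπ := by
    refine measurable_to_countable' fun k => ?_
    rcases k with _ | k
    · have : Tπ ⁻¹' {0} = (⋃ k, {ω | Tπ ω = k + 1})ᶜ := by
        ext ω
        rw [mem_preimage, mem_singleton_iff, mem_compl_iff, mem_iUnion]
        constructor
        · rintro h ⟨k, hk : Tπ ω = k + 1⟩
          omega
        · intro h
          by_contra hne
          exact h ⟨Tπ ω - 1, (Nat.succ_pred hne).symm⟩
      rw [this]
      exact (MeasurableSet.iUnion hTsucc).compl
    · exact hTsucc k
  have hmain := dK_map_expMeasure_le (μ := μ) (T := Tπ) (R := Tii) hTmeas hπi ?_ ?_ ?_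
  · rw [← measureReal_def]
    linarith
  · rw [← ENNReal.toReal_ofReal hπi.le, ← hX0, ← measureReal_def]
    refine measureReal_mono fun ω (hω : X 0 ω = i) => ?_
    rw [mem_ofPred_eq, hTπ]
    exact Nat.sInf_eq_zero.2 (Or.inl hω)
  · filter_upwards [hreturn] with ω hω
    rw [hTii]
    exact (Nat.sInf_mem hω).1
  · intro k
    have hae : {ω | k + 1 < Tii ω} =ᵐ[μ] avoidSet Y i 1 (k + 1) := by
      filter_upwards [hreturn] with ω hω
      refine propext ?_
      change k + 1 < Tii ω ↔ _
      rw [hTii]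
      exact lt_sInf_iff_mem_avoidSet hω (k + 1)
    rw [measureReal_congr hae, ← hstep, hTset, measureReal_sdiff
      (antitone_avoidSet X i 0 (Nat.le_succ _)) (measurableSet_avoidSet hX.1 _ _ _)]

end
end
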